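/- arXiv:2506.08307 — 2 statements merged into one kernel-verified Lean document; each statement's English description precedes it below -/
import Mathlib

section
/- Let n > 1, k ≥ 3, and let g_1, …, g_n ∈ C_0^k(M^n, 𝔸) have compact support. If ∂̄_i(∂_j g_j) = Δ_j g_i on M^n for all i, j ∈ {1, …, n}, then the function f(x) := −∫_M E(y_1 − x_1) g_1(y_1, x^0) dV(y_1), x = (x_1, x^0) ∈ M^n, belongs to C^k(M^n, 𝔸), has compact support, satisfies ∂̄_j f = g_j on M^n for j = 1, …, n, and vanishes on the unbounded connected component of M^n ∖ (supp g_1 ∪ ⋯ ∪ supp g_n). -/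
open MeasureTheory

noncomputable section

/-- A real alternative `*`-algebra of finite dimension `> 1`, with a fixed
hypercomplex basis `v 0 = 1, v 1, …, v m` spanning the hypercomplex subspace `M`.
Multiplication is `ℝ`-bilinear (bundled as a linear map). -/
structure HCAlg (𝔸 : Type) [NormedAddCommGroup 𝔸] [NormedSpace ℝ 𝔸] (m : ℕ) : Type where
  mul : 𝔸 →ₗ[ℝ] 𝔸 →ₗ[ℝ] 𝔸
  one : 𝔸
  conj : 𝔸 →ₗ[ℝ] 𝔸
  findim : FiniteDimensional ℝ 𝔸
  dim_gt_one : 1 < Module.finrank ℝ 𝔸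
  one_mul' : ∀ a, mul one a = a
  mul_one' : ∀ a, mul a one = a
  alt_left : ∀ a b, mul a (mul a b) = mul (mul a a) b
  alt_right : ∀ a b, mul (mul b a) a = mul b (mul a a)
  conj_invol : ∀ a, conj (conj a) = a
  conj_mul' : ∀ a b, conj (mul a b) = mul (conj b) (conj a)
  conj_one : conj one = one
  hm : 1 ≤ m
  v : Fin (m + 1) → 𝔸
  v_indep : LinearIndependent ℝ v
  v_zero : v 0 = one
  v_trace : ∀ s, s ≠ 0 → v s + conj (v s) = 0
  v_norm : ∀ s, s ≠ 0 → mul (v s) (conj (v s)) = one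
  v_anticomm : ∀ s t, s ≠ 0 → t ≠ 0 → s ≠ t → mul (v s) (v t) = -(mul (v t) (v s))

variable {𝔸 : Type} [NormedAddCommGroup 𝔸] [NormedSpace ℝ 𝔸] {m n : ℕ}

/-- `M^n`, identified with `ℝ^{(m+1)n}` via the coordinates `x j s`. -/
abbrev Mn (n m : ℕ) := Fin n → Fin (m + 1) → ℝ

/-- Euclidean norm of a point of `M` (in coordinates). -/
def enormM (c : Fin (m + 1) → ℝ) : ℝ := Real.sqrt (∑ s, c s ^ 2)

/-- Euclidean norm of a point of `M^n` (in coordinates). -/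
def enormMn (x : Mn n m) : ℝ := Real.sqrt (∑ j, ∑ s, x j s ^ 2)

/-- Partial derivative `∂f/∂x_{j,s}` for functions on `M^n`. -/
def pd {E : Type} [NormedAddCommGroup E] [NormedSpace ℝ E]
    (f : Mn n m → E) (j : Fin n) (s : Fin (m + 1)) (x : Mn n m) : E :=
  fderiv ℝ f x (Pi.single j (Pi.single s 1))

/-- Partial derivative `∂f/∂x_s` for functions on `M`. -/
def pd1 {E : Type} [NormedAddCommGroup E] [NormedSpace ℝ E]
    (f : (Fin (m + 1) → ℝ) → E) (s : Fin (m + 1)) (x : Fin (m + 1) → ℝ) : E :=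
  fderiv ℝ f x (Pi.single s 1)

/-- The Dirac (Cauchy–Riemann) operator `∂̄_j = ∑_s v_s ∂/∂x_{j,s}`. -/
def dbar (H : HCAlg 𝔸 m) (f : Mn n m → 𝔸) (j : Fin n) (x : Mn n m) : 𝔸 :=
  ∑ s, H.mul (H.v s) (pd f j s x)

/-- The conjugated Dirac operator `∂_j = ∑_s v_s^c ∂/∂x_{j,s}`. -/
def dconj (H : HCAlg 𝔸 m) (f : Mn n m → 𝔸) (j : Fin n) (x : Mn n m) : 𝔸 :=
  ∑ s, H.mul (H.conj (H.v s)) (pd f j s x)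

/-- The Laplacian `Δ_j = ∑_s ∂²/∂x_{j,s}²` in the `j`-th block of variables. -/
def lap {E : Type} [NormedAddCommGroup E] [NormedSpace ℝ E]
    (f : Mn n m → E) (j : Fin n) (x : Mn n m) : E :=
  ∑ s, pd (pd f j s) j s x

/-- Surface area of the unit `(N-1)`-sphere in `ℝ^N`: `σ_N = 2 π^{N/2} / Γ(N/2)`. -/
def usigma (N : ℕ) : ℝ := 2 * Real.pi ^ ((N : ℝ) / 2) / Real.Gamma ((N : ℝ) / 2)

/-- Embedding of coordinates into the hypercomplex subspace `M ⊆ 𝔸`. -/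
def embM (H : HCAlg 𝔸 m) (c : Fin (m + 1) → ℝ) : 𝔸 := ∑ s, c s • H.v s

/-- The Cauchy kernel `E(x) = σ_{m+1}⁻¹ x^c / |x|^{m+1}` on `M`. -/
def CauchyE (H : HCAlg 𝔸 m) (c : Fin (m + 1) → ℝ) : 𝔸 :=
  (usigma (m + 1) * enormM c ^ (m + 1))⁻¹ • H.conj (embM H c)

/-- The Bochner–Martinelli kernel components `K_j(x) = σ_N⁻¹ x_j^c / |x|^N`, `N = (m+1)n`. -/
def Kker (H : HCAlg 𝔸 m) (n : ℕ) (j : Fin n) (x : Mn n m) : 𝔸 :=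
  (usigma ((m + 1) * n) * enormMn x ^ ((m + 1) * n))⁻¹ • H.conj (embM H (x j))

/-- `Tsol g (x) = −∫_M E(y₁ − x₁) (g(y₁, x⁰)) dV(y₁)`. -/
def Tsol (H : HCAlg 𝔸 m) (hn : 0 < n) (g : Mn n m → 𝔸) (x : Mn n m) : 𝔸 :=
  - ∫ y1 : Fin (m + 1) → ℝ,
      H.mul (CauchyE H (y1 - x ⟨0, hn⟩)) (g (Function.update x ⟨0, hn⟩ y1))

/-- `Fint g (x) = ∫_M E(y₁) (g(y₁ + x₁, x⁰)) dV(y₁)`. -/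
def Fint (H : HCAlg 𝔸 m) (hn : 0 < n) (g : Mn n m → 𝔸) (x : Mn n m) : 𝔸 :=
  ∫ y1 : Fin (m + 1) → ℝ,
      H.mul (CauchyE H y1) (g (Function.update x ⟨0, hn⟩ (y1 + x ⟨0, hn⟩)))

section Potential
open Set Filter Topology Module Metric
open scoped RealInnerProductSpace

variable {E F : Type*} [NormedAddCommGroup E] [NormedAddCommGroup F] [NormedSpace ℝ F]
  [MeasurableSpace E] [BorelSpace E]

section Normed
variable [NormedSpace ℝ E] [FiniteDimensional ℝ E] [Nontrivial E]
  (μ : Measure E) [μ.IsAddHaarMeasure]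

omit [NormedSpace ℝ F] in
/-- A function dominated by `‖y‖ ^ (1 - dim E)` is locally integrable. -/
theorem locallyIntegrable_of_norm_le_norm_mul_inv_pow {f : E → F} {C : ℝ}
    (hf : AEStronglyMeasurable f μ)
    (hbd : ∀ y, ‖f y‖ ≤ C * (‖y‖ * (‖y‖ ^ finrank ℝ E)⁻¹)) : LocallyIntegrable f μ := by
  have hpos : 1 ≤ finrank ℝ E := finrank_pos
  refine locallyIntegrable_of_norm_le_rpow (C := C) (α := (finrank ℝ E : ℝ) - 1) hpos
    (by linarith) ?_ hf
  filter_upwards [compl_mem_ae_iff.2 (measure_singleton (μ := μ) (0 : E))] with y hy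
  have hy' : 0 < ‖y‖ := norm_pos_iff.2 hy
  convert! hbd y using 2
  rw [neg_sub, Real.rpow_sub hy', Real.rpow_one, Real.rpow_natCast, div_eq_mul_inv]

/-- Integration in polar coordinates of the radial derivative against `‖y‖ ^ (-dim E)`. -/
theorem integral_inv_norm_pow_smul_fderiv_self [CompleteSpace F] {φ : E → F}
    (hφ : ContDiff ℝ 1 φ) (hc : HasCompactSupport φ) :
    ∫ y, (‖y‖ ^ finrank ℝ E)⁻¹ • fderiv ℝ φ y y ∂μ =
      -((finrank ℝ E * μ.real (ball 0 1)) • φ 0) := by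
  set N := finrank ℝ E with hN
  have hpos : 1 ≤ N := finrank_pos
  set h : E → F := fun y => (‖y‖ ^ N)⁻¹ • fderiv ℝ φ y y with hh
  have hcont : Continuous (fderiv ℝ φ) := hφ.continuous_fderiv one_ne_zero
  have hcs : HasCompactSupport (fderiv ℝ φ) := hc.fderiv ℝ
  obtain ⟨C, hC⟩ := hcs.exists_bound_of_continuous hcont
  have hloc : LocallyIntegrable h μ := by
    refine locallyIntegrable_of_norm_le_norm_mul_inv_pow μ (C := C) ?_ fun y => ?_
    · refine AEStronglyMeasurable.smul ?_ ?_
      · exact (((measurable_norm).pow_const N).inv).aestronglyMeasurable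
      · exact (hcont.clm_apply continuous_id).aestronglyMeasurable
    · rw [hh, norm_smul, norm_inv, norm_pow, norm_norm, ← hN]
      have := (fderiv ℝ φ y).le_of_opNorm_le (hC y) y
      calc _ ≤ (‖y‖ ^ N)⁻¹ * (C * ‖y‖) := by gcongr
        _ = _ := by ring
  have h_int : Integrable h μ := by
    have hs : HasCompactSupport h := by
      refine hcs.mono' (subset_trans ?_ (subset_tsupport _))
      intro y hy h0
      exact hy (by simp only [hh, h0]; simp)
    rw [← integrableOn_iff_integrable_of_support_subset (subset_tsupport h)]
    exact hloc.integrableOn_isCompact hs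
  have hmp := μ.measurePreserving_homeomorphUnitSphereProd
  have hemb := (homeomorphUnitSphereProd E).measurableEmbedding
  set H : sphere (0 : E) 1 × Ioi (0 : ℝ) → F := fun p => h (p.2.1 • p.1.1) with hH
  have hHcomp : ∀ x : ({0}ᶜ : Set E), H (homeomorphUnitSphereProd E x) = h x := by
    intro x
    have := homeomorphUnitSphereProd_symm_apply_coe E (homeomorphUnitSphereProd E x)
    rw [Homeomorph.symm_apply_apply] at this
    rw [hH, this]
  have e1 : ∫ y, h y ∂μ = ∫ p, H p ∂(μ.toSphere.prod (.volumeIoiPow (N - 1))) := by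
    rw [← hmp.integral_comp hemb H]
    simp only [hHcomp]
    rw [integral_subtype_comap (measurableSet_singleton _).compl h, restrict_compl_singleton]
  have hHint : Integrable H (μ.toSphere.prod (.volumeIoiPow (N - 1))) := by
    rw [← hmp.integrable_comp_emb hemb]
    have : (H ∘ homeomorphUnitSphereProd E) = h ∘ ((↑) : ({0}ᶜ : Set E) → E) :=
      funext hHcomp
    rw [this, ← (MeasurableEmbedding.subtype_coe
      (measurableSet_singleton (0 : E)).compl).integrableOn_range_iff_comap]
    exact h_int.integrableOn
  rw [e1, integral_prod _ hHint]
  have inner : ∀ w : sphere (0 : E) 1,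
      ∫ r : Ioi (0 : ℝ), H (w, r) ∂(.volumeIoiPow (N - 1)) = - φ 0 := by
    intro w
    have hw : ‖(w : E)‖ = 1 := by simp
    have hline : ∀ r : ℝ, HasDerivAt (fun r : ℝ => φ (r • (w : E)))
        (fderiv ℝ φ (r • (w : E)) w) r := by
      intro r
      have h1 := (hφ.differentiable one_ne_zero (r • (w : E))).hasFDerivAt
      have h2 : HasDerivAt (fun r : ℝ => r • (w : E)) ((1 : ℝ) • (w : E)) r :=
        (hasDerivAt_id r).smul_const _
      have h3 := h1.comp_hasDerivAt r h2
      rw [one_smul] at h3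
      exact h3
    have hcl : HasCompactSupport (fun r : ℝ => φ (r • (w : E))) := by
      refine hc.comp_isClosedEmbedding (g := fun r : ℝ => r • (w : E)) ?_
      exact isClosedEmbedding_smul_left (by rintro h0; simp [h0] at hw)
    have hd1 : ContDiff ℝ 1 (fun r : ℝ => φ (r • (w : E))) :=
      hφ.comp (contDiff_id.smul contDiff_const)
    have := hcl.integral_Ioi_deriv_eq hd1 0
    rw [zero_smul] at this
    rw [← this]
    simp only [Measure.volumeIoiPow, ENNReal.ofReal]
    rw [integral_withDensity_eq_integral_smul,
      integral_subtype_comap measurableSet_Ioi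
        fun a ↦ Real.toNNReal (a ^ (N - 1)) • h (a • (w : E)),
      setIntegral_congr_fun measurableSet_Ioi fun x hx ↦ ?_]
    · have hx' : (0 : ℝ) < x := hx
      rw [NNReal.smul_def, Real.coe_toNNReal _ (pow_nonneg hx'.le _), (hline x).deriv, hh]
      simp only [norm_smul, hw, map_smul, smul_smul, Real.norm_eq_abs, abs_of_pos hx', mul_one]
      obtain ⟨k, hk⟩ : ∃ k, N = k + 1 := ⟨N - 1, by omega⟩
      rw [hk, Nat.add_sub_cancel]
      have : x ^ k * (x ^ (k + 1))⁻¹ * x = 1 := by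
        rw [pow_succ]
        field_simp
      rw [← mul_assoc, this, one_smul]
    · exact (measurable_subtype_coe.pow_const _).real_toNNReal
  simp only [inner]
  rw [integral_const, μ.toSphere_real_apply_univ, smul_neg]
end Normed

section Inner
variable [InnerProductSpace ℝ E] [FiniteDimensional ℝ E]

/-- The component in direction `v` of the gradient of a potential whose profile has derivative
`ρ ^ (-dim E / 2) / 2` in the variable `ρ = ‖y‖ ^ 2 + ε`. -/
def regKernel (v : E) (ε : ℝ) (y : E) : ℝ :=
  ⟪y, v⟫ * (‖y‖ ^ 2 + ε) ^ (-((finrank ℝ E : ℝ) / 2))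

/-- The component in direction `v` of the (unnormalised) singular kernel `y / ‖y‖ ^ dim E`. -/
def singKernel (v y : E) : ℝ := ⟪y, v⟫ * (‖y‖ ^ finrank ℝ E)⁻¹

omit [MeasurableSpace E] [BorelSpace E] [InnerProductSpace ℝ E] [FiniteDimensional ℝ E] in
theorem rpow_norm_sq (y : E) (N : ℕ) :
    (‖y‖ ^ 2 : ℝ) ^ (-((N : ℝ) / 2)) = (‖y‖ ^ N)⁻¹ := by
  rw [Real.rpow_neg (by positivity), ← Real.rpow_natCast, ← Real.rpow_mul (norm_nonneg y)]
  rw [show ((2 : ℕ) : ℝ) * ((N : ℝ) / 2) = N by push_cast; ring, Real.rpow_natCast]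

omit [MeasurableSpace E] [BorelSpace E] [FiniteDimensional ℝ E] in
theorem regKernel_bound (v : E) {ε : ℝ} (hε : 0 ≤ ε) (y : E) :
    |regKernel v ε y| ≤ ‖v‖ * (‖y‖ * (‖y‖ ^ finrank ℝ E)⁻¹) := by
  rcases eq_or_ne y 0 with rfl | hy
  · simp [regKernel]
  have hy' : 0 < ‖y‖ := norm_pos_iff.2 hy
  rw [regKernel, abs_mul, ← rpow_norm_sq y,
    abs_of_nonneg (Real.rpow_nonneg (by positivity : (0 : ℝ) ≤ ‖y‖ ^ 2 + ε) _)]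
  have h1 : |⟪y, v⟫| ≤ ‖y‖ * ‖v‖ := abs_real_inner_le_norm y v
  have h2 : (‖y‖ ^ 2 + ε) ^ (-((finrank ℝ E : ℝ) / 2)) ≤
      (‖y‖ ^ 2) ^ (-((finrank ℝ E : ℝ) / 2)) :=
    Real.rpow_le_rpow_of_nonpos (by positivity) (by linarith)
      (neg_nonpos.2 (by positivity))
  calc _ ≤ (‖y‖ * ‖v‖) * (‖y‖ ^ 2) ^ (-((finrank ℝ E : ℝ) / 2)) := by gcongr
    _ = _ := by ring

omit [MeasurableSpace E] [BorelSpace E] [FiniteDimensional ℝ E] in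
theorem regKernel_zero (v y : E) : regKernel v 0 y = singKernel v y := by
  rw [regKernel, singKernel, add_zero, rpow_norm_sq]

omit [MeasurableSpace E] [BorelSpace E] [FiniteDimensional ℝ E] in
theorem singKernel_bound (v y : E) :
    ‖singKernel v y‖ ≤ ‖v‖ * (‖y‖ * (‖y‖ ^ finrank ℝ E)⁻¹) := by
  rw [← regKernel_zero]
  exact regKernel_bound v le_rfl y

omit [FiniteDimensional ℝ E] in
theorem measurable_regKernel (v : E) (ε : ℝ) : Measurable (regKernel v ε) := by
  have h1 : Measurable fun y : E => ⟪y, v⟫ :=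
    (continuous_id.inner continuous_const).measurable
  have h2 : Measurable fun y : E => ‖y‖ := measurable_norm
  exact h1.mul (((h2.pow_const 2).add_const ε).pow_const _)

variable [Nontrivial E]

theorem locallyIntegrable_singKernel (μ : Measure E) [μ.IsAddHaarMeasure] (v : E) :
    LocallyIntegrable (singKernel v) μ := by
  refine locallyIntegrable_of_norm_le_norm_mul_inv_pow μ (C := ‖v‖) ?_ (singKernel_bound v)
  rw [show singKernel v = regKernel v 0 from funext fun y => (regKernel_zero v y).symm]
  exact (measurable_regKernel v 0).aestronglyMeasurable

theorem tendsto_integral_regKernel (μ : Measure E) [μ.IsAddHaarMeasure] (v : E) {ψ : E → F}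
    (hψ : Continuous ψ) (hc : HasCompactSupport ψ) :
    Tendsto (fun ε => ∫ y, regKernel v ε y • ψ y ∂μ) (𝓝[>] 0)
      (𝓝 (∫ y, singKernel v y • ψ y ∂μ)) := by
  refine tendsto_integral_filter_of_dominated_convergence
    (fun y => ‖v‖ * (‖y‖ * (‖y‖ ^ finrank ℝ E)⁻¹) * ‖ψ y‖) ?_ ?_ ?_ ?_
  · exact Eventually.of_forall fun ε =>
      (measurable_regKernel v ε).aestronglyMeasurable.smul hψ.aestronglyMeasurable
  · filter_upwards [self_mem_nhdsWithin] with ε hε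
    refine Eventually.of_forall fun y => ?_
    rw [norm_smul]
    exact mul_le_mul_of_nonneg_right (regKernel_bound v (le_of_lt hε) y) (norm_nonneg _)
  · have hloc : LocallyIntegrable (fun y : E => ‖v‖ * (‖y‖ * (‖y‖ ^ finrank ℝ E)⁻¹)) μ := by
      refine locallyIntegrable_of_norm_le_norm_mul_inv_pow μ (C := ‖v‖) ?_ fun y => ?_
      · have h2 : Measurable fun y : E => ‖y‖ := measurable_norm
        exact ((h2.mul (h2.pow_const _).inv).const_mul _).aestronglyMeasurable
      · rw [Real.norm_of_nonneg (by positivity)]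
    exact hloc.integrable_smul_right_of_hasCompactSupport hψ.norm hc.norm
  · filter_upwards [compl_mem_ae_iff.2 (measure_singleton (μ := μ) (0 : E))] with y hy
    have hy' : 0 < ‖y‖ := norm_pos_iff.2 hy
    rw [← regKernel_zero]
    refine Tendsto.smul_const ?_ _
    have : ContinuousAt (fun ε : ℝ => regKernel v ε y) 0 := by
      refine continuousAt_const.mul (ContinuousAt.rpow_const (by fun_prop) (Or.inl ?_))
      positivity
    exact this.tendsto.mono_left nhdsWithin_le_nhds

variable {L : ℝ → ℝ}

omit [MeasurableSpace E] [BorelSpace E] [FiniteDimensional ℝ E] [Nontrivial E] in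
theorem hasFDerivAt_profile
    (hL : ∀ ρ, 0 < ρ → HasDerivAt L (ρ ^ (-((finrank ℝ E : ℝ) / 2)) / 2) ρ)
    {ε : ℝ} (hε : 0 < ε) (y : E) :
    HasFDerivAt (fun y : E => L (‖y‖ ^ 2 + ε))
      (((‖y‖ ^ 2 + ε) ^ (-((finrank ℝ E : ℝ) / 2))) • innerSL ℝ y) y := by
  have h1 : HasFDerivAt (fun y : E => ‖y‖ ^ 2 + ε) (2 • innerSL ℝ y) y :=
    ((hasStrictFDerivAt_norm_sq y).hasFDerivAt).add_const ε
  have := (hL (‖y‖ ^ 2 + ε) (by positivity)).comp_hasFDerivAt y h1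
  convert! this using 1
  ext v
  simp
  ring

omit [Nontrivial E] in
theorem integral_profile_smul_fderiv (μ : Measure E) [μ.IsAddHaarMeasure]
    (hL : ∀ ρ, 0 < ρ → HasDerivAt L (ρ ^ (-((finrank ℝ E : ℝ) / 2)) / 2) ρ)
    {ε : ℝ} (hε : 0 < ε) (v : E) {ψ : E → F}
    (hψ : ContDiff ℝ 1 ψ) (hc : HasCompactSupport ψ) :
    ∫ y, L (‖y‖ ^ 2 + ε) • fderiv ℝ ψ y v ∂μ = -∫ y, regKernel v ε y • ψ y ∂μ := by
  have hd := hasFDerivAt_profile (E := E) hL hε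
  have hLc : Continuous fun y : E => L (‖y‖ ^ 2 + ε) :=
    continuous_iff_continuousAt.2 fun y => (hd y).continuousAt
  have hk : ∀ y, fderiv ℝ (fun y : E => L (‖y‖ ^ 2 + ε)) y v = regKernel v ε y := by
    intro y
    rw [(hd y).fderiv, regKernel]
    simp [mul_comm]
  have hkc : Continuous (regKernel v ε) := by
    refine (continuous_id.inner continuous_const).mul
      (Continuous.rpow_const (by fun_prop) fun y => Or.inl ?_)
    positivity
  have := integral_smul_fderiv_eq_neg_fderiv_smul_of_integrable (μ := μ)
    (f := fun y : E => L (‖y‖ ^ 2 + ε)) (g := ψ) (v := v) ?_ ?_ ?_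
    (fun y _ => (hd y).differentiableAt) (fun y _ => hψ.differentiable one_ne_zero y)
  · rw [this]
    simp only [hk]
  · simp only [hk]
    exact (hkc.smul hψ.continuous).integrable_of_hasCompactSupport hc.smul_left
  · exact (hLc.smul ((hψ.continuous_fderiv one_ne_zero).clm_apply
      continuous_const)).integrable_of_hasCompactSupport (hc.fderiv_apply ℝ v).smul_left
  · exact (hLc.smul hψ.continuous).integrable_of_hasCompactSupport hc.smul_left

/-- The Laplacian of `φ` computed in an orthonormal basis. -/
def basisLaplacian {ι : Type*} [Fintype ι] (b : OrthonormalBasis ι ℝ E) (φ : E → F) (y : E) : F :=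
  ∑ i, fderiv ℝ (fun z => fderiv ℝ φ z (b i)) y (b i)

/-- The regularised potential of the Laplacian of a test function recovers its value at `0`. -/
theorem tendsto_integral_profile_smul_laplacian [CompleteSpace F] {ι : Type*} [Fintype ι]
    (b : OrthonormalBasis ι ℝ E) (μ : Measure E) [μ.IsAddHaarMeasure]
    (hL : ∀ ρ, 0 < ρ → HasDerivAt L (ρ ^ (-((finrank ℝ E : ℝ) / 2)) / 2) ρ)
    {φ : E → F} (hφ : ContDiff ℝ 2 φ) (hc : HasCompactSupport φ) :
    Tendsto (fun ε => ∫ y, L (‖y‖ ^ 2 + ε) • basisLaplacian b φ y ∂μ) (𝓝[>] 0)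
      (𝓝 ((finrank ℝ E * μ.real (ball 0 1)) • φ 0)) := by
  have hφ1 : ∀ i, ContDiff ℝ 1 fun z => fderiv ℝ φ z (b i) := fun i =>
    (hφ.fderiv_right (m := 1) (by norm_num)).clm_apply contDiff_const
  have hc1 : ∀ i, HasCompactSupport fun z => fderiv ℝ φ z (b i) := fun i =>
    hc.fderiv_apply ℝ (b i)
  have h_int : ∀ i, Integrable (fun y => singKernel (b i) y • fderiv ℝ φ y (b i)) μ := fun i =>
    (locallyIntegrable_singKernel μ (b i)).integrable_smul_right_of_hasCompactSupport
      (hφ1 i).continuous (hc1 i)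
  have hsum : -∑ i, ∫ y, singKernel (b i) y • fderiv ℝ φ y (b i) ∂μ =
      (finrank ℝ E * μ.real (ball 0 1)) • φ 0 := by
    rw [← integral_finsetSum _ fun i _ => h_int i, neg_eq_iff_eq_neg,
      ← integral_inv_norm_pow_smul_fderiv_self μ (hφ.of_le (by norm_num)) hc]
    congr 1
    ext y
    conv_rhs => rw [← b.sum_repr' y]
    simp only [map_sum, map_smul, Finset.smul_sum, smul_smul, singKernel]
    refine Finset.sum_congr rfl fun i _ => ?_
    rw [b.sum_repr', real_inner_comm, mul_comm]
  rw [← hsum]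
  have hlim := (tendsto_finsetSum (Finset.univ : Finset ι) fun i _ =>
    tendsto_integral_regKernel μ (b i) (hφ1 i).continuous (hc1 i)).neg
  refine hlim.congr' ?_
  filter_upwards [self_mem_nhdsWithin] with ε hε
  have hε' : (0 : ℝ) < ε := hε
  have hLc : Continuous fun y : E => L (‖y‖ ^ 2 + ε) :=
    continuous_iff_continuousAt.2 fun y => (hasFDerivAt_profile hL hε' y).continuousAt
  simp only [basisLaplacian, Finset.smul_sum]
  rw [integral_finsetSum, ← Finset.sum_neg_distrib]
  · exact Finset.sum_congr rfl fun i _ =>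
      (integral_profile_smul_fderiv μ hL hε' (b i) (hφ1 i) (hc1 i)).symm
  · intro i _
    exact (hLc.smul (((hφ1 i).continuous_fderiv one_ne_zero).clm_apply
      continuous_const)).integrable_of_hasCompactSupport ((hc1 i).fderiv_apply ℝ _).smul_left

section UniqueContinuation
variable {ι : Type*} [Fintype ι] (b : OrthonormalBasis ι ℝ E)

omit [MeasurableSpace E] [BorelSpace E] [FiniteDimensional ℝ E] [Nontrivial E] in
theorem basisLaplacian_congr {φ ψ : E → F} {y : E} (h : φ =ᶠ[𝓝 y] ψ) :
    basisLaplacian b φ y = basisLaplacian b ψ y := by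
  refine Finset.sum_congr rfl fun i _ => ?_
  have : (fun z => fderiv ℝ φ z (b i)) =ᶠ[𝓝 y] fun z => fderiv ℝ ψ z (b i) :=
    (h.fderiv (𝕜 := ℝ)).mono fun z hz => by simp only [hz]
  rw [this.fderiv_eq]

omit [MeasurableSpace E] [BorelSpace E] [FiniteDimensional ℝ E] [Nontrivial E] in
theorem continuous_basisLaplacian {φ : E → F} (hφ : ContDiff ℝ 2 φ) :
    Continuous (basisLaplacian b φ) := by
  refine continuous_finsetSum _ fun i _ => ?_
  have : ContDiff ℝ 1 fun z => fderiv ℝ φ z (b i) :=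
    (hφ.fderiv_right (m := 1) (by norm_num)).clm_apply contDiff_const
  exact (this.continuous_fderiv one_ne_zero).clm_apply continuous_const

omit [MeasurableSpace E] [BorelSpace E] [FiniteDimensional ℝ E] [Nontrivial E] in
theorem tsupport_basisLaplacian_subset (φ : E → F) :
    tsupport (basisLaplacian b φ) ⊆ tsupport φ := by
  refine closure_minimal (fun y hy => ?_) (isClosed_tsupport φ)
  by_contra hn
  refine hy ?_
  rw [basisLaplacian_congr b (notMem_tsupport_iff_eventuallyEq.1 hn)]
  simp [basisLaplacian]

/-- The profile of the Newtonian potential in dimension `> 2`. -/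
def newtonProfile (N : ℕ) (ρ : ℝ) : ℝ := ρ ^ (1 - (N : ℝ) / 2) / (2 - N)

theorem hasDerivAt_newtonProfile {N : ℕ} (hN : 2 < N) {ρ : ℝ} (hρ : 0 < ρ) :
    HasDerivAt (newtonProfile N) (ρ ^ (-((N : ℝ) / 2)) / 2) ρ := by
  have h2 : (2 : ℝ) - N ≠ 0 := by
    have : (2 : ℝ) < N := by exact_mod_cast hN
    linarith
  have := (Real.hasDerivAt_rpow_const (p := 1 - (N : ℝ) / 2) (Or.inl hρ.ne')).div_const (2 - (N : ℝ))
  convert! this using 1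
  rw [show 1 - (N : ℝ) / 2 - 1 = -((N : ℝ) / 2) by ring]
  field_simp

theorem abs_newtonProfile_le {N : ℕ} (hN : 2 < N) {ρ σ : ℝ} (hρ : 0 < ρ) (h : ρ ≤ σ) :
    |newtonProfile N σ| ≤ |newtonProfile N ρ| := by
  have hN' : (2 : ℝ) < N := by exact_mod_cast hN
  rw [newtonProfile, newtonProfile, abs_div, abs_div,
    abs_of_nonneg (Real.rpow_nonneg hρ.le _), abs_of_nonneg (Real.rpow_nonneg (hρ.le.trans h) _)]
  gcongr ?_ / _
  exact Real.rpow_le_rpow_of_nonpos hρ h (by linarith)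

theorem mul_eq_integral_newtonProfile (μ : Measure E) [μ.IsAddHaarMeasure]
    (hN : 2 < finrank ℝ E) {φ : E → ℝ} (hφ : ContDiff ℝ 2 φ) (hc : HasCompactSupport φ)
    {x : E} {δ : ℝ} (hδ : 0 < δ) (h0 : ∀ y, basisLaplacian b φ y ≠ 0 → δ ≤ ‖y - x‖) :
    (finrank ℝ E * μ.real (ball 0 1)) * φ x =
      ∫ y, newtonProfile (finrank ℝ E) (‖y - x‖ ^ 2) * basisLaplacian b φ y ∂μ := by
  set N := finrank ℝ E with hNdef
  have hshift : ∀ y, basisLaplacian b (fun y => φ (y + x)) y = basisLaplacian b φ (y + x) := by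
    intro y
    simp only [basisLaplacian, fderiv_comp_add_right]
    refine Finset.sum_congr rfl fun i _ => ?_
    rw [fderiv_comp_add_right (f := fun z => fderiv ℝ φ z (b i))]
  have hcl : HasCompactSupport (basisLaplacian b φ) :=
    hc.mono' ((subset_tsupport _).trans (tsupport_basisLaplacian_subset b φ))
  have hlint : Integrable (basisLaplacian b φ) μ :=
    (continuous_basisLaplacian b hφ).integrable_of_hasCompactSupport hcl
  have hlim := tendsto_integral_profile_smul_laplacian b μ
    (L := newtonProfile N) (fun ρ hρ => hasDerivAt_newtonProfile hN hρ)
    (φ := fun y => φ (y + x)) (hφ.comp (contDiff_id.add contDiff_const))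
    (hc.comp_homeomorph (Homeomorph.addRight x))
  have heq : ∀ ε : ℝ, (∫ y, newtonProfile N (‖y‖ ^ 2 + ε) •
        basisLaplacian b (fun y => φ (y + x)) y ∂μ) =
      ∫ y, newtonProfile N (‖y - x‖ ^ 2 + ε) * basisLaplacian b φ y ∂μ := by
    intro ε
    rw [← integral_add_right_eq_self
      (fun y => newtonProfile N (‖y - x‖ ^ 2 + ε) * basisLaplacian b φ y) x]
    refine integral_congr_ae (Eventually.of_forall fun y => ?_)
    simp only [add_sub_cancel_right, ← hshift, smul_eq_mul]
  replace hlim := hlim.congr heq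
  simp only [zero_add, smul_eq_mul] at hlim
  refine tendsto_nhds_unique hlim ?_
  refine tendsto_integral_filter_of_dominated_convergence
    (fun y => |newtonProfile N (δ ^ 2)| * ‖basisLaplacian b φ y‖) ?_ ?_ (hlint.norm.const_mul _) ?_
  · refine Eventually.of_forall fun ε => ?_
    refine Measurable.aestronglyMeasurable ?_ |>.mul hlint.aestronglyMeasurable
    have h2 : Measurable fun y : E => ‖y - x‖ := by fun_prop
    exact (((h2.pow_const 2).add_const ε).pow_const _).div_const _
  · filter_upwards [self_mem_nhdsWithin] with ε hε
    refine Eventually.of_forall fun y => ?_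
    rw [norm_mul]
    by_cases hy : basisLaplacian b φ y = 0
    · simp [hy]
    have hd := h0 y hy
    refine mul_le_mul_of_nonneg_right ?_ (norm_nonneg _)
    refine abs_newtonProfile_le hN (by positivity) ?_
    have : (0 : ℝ) < ε := hε
    nlinarith
  · refine Eventually.of_forall fun y => ?_
    by_cases hy : basisLaplacian b φ y = 0
    · simp [hy]
    have hd := h0 y hy
    refine Tendsto.mul_const _ ?_
    have hpos : 0 < ‖y - x‖ ^ 2 + 0 := by
      have := hδ.trans_le hd
      rw [add_zero]
      exact pow_pos this 2
    have h1 : ContinuousAt (fun ε : ℝ => newtonProfile N (‖y - x‖ ^ 2 + ε)) 0 :=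
      ContinuousAt.comp (g := newtonProfile N)
        (hasDerivAt_newtonProfile hN hpos).continuousAt (by fun_prop)
    simpa using h1.tendsto.mono_left nhdsWithin_le_nhds

/-- A holomorphic extension of `t ↦ newtonProfile N (‖c + t • w‖ ^ 2)`. -/
def complexProfile (N : ℕ) (c w : E) (z : ℂ) : ℂ :=
  ((‖c‖ ^ 2 : ℝ) + 2 * z * (⟪c, w⟫ : ℝ) + z ^ 2 * (‖w‖ ^ 2 : ℝ)) ^ ((1 - N / 2 : ℝ) : ℂ) / (2 - N)

omit [MeasurableSpace E] [BorelSpace E] [FiniteDimensional ℝ E] [Nontrivial E] in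
theorem complexProfile_ofReal (N : ℕ) (c w : E) (t : ℝ) :
    complexProfile N c w t = newtonProfile N (‖c + t • w‖ ^ 2) := by
  have : ‖c + t • w‖ ^ 2 = ‖c‖ ^ 2 + 2 * t * ⟪c, w⟫ + t ^ 2 * ‖w‖ ^ 2 := by
    rw [norm_add_sq_real, inner_smul_right, norm_smul, mul_pow, Real.norm_eq_abs, sq_abs]
    ring
  rw [newtonProfile, Complex.ofReal_div, Complex.ofReal_cpow (by positivity), this,
    complexProfile]
  push_cast
  rfl

omit [MeasurableSpace E] [BorelSpace E] [FiniteDimensional ℝ E] [Nontrivial E] in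
theorem re_complexProfile_base_pos {c w : E} {z : ℂ} (hc : 8 * ‖w‖ < ‖c‖) (hz : ‖z‖ < 2) :
    0 < ((‖c‖ ^ 2 : ℝ) + 2 * z * (⟪c, w⟫ : ℝ) + z ^ 2 * (‖w‖ ^ 2 : ℝ) : ℂ).re := by
  have hw := norm_nonneg w
  have h1 : |z.re * ⟪c, w⟫| ≤ 2 * (‖c‖ * ‖w‖) := by
    rw [abs_mul]
    exact mul_le_mul ((Complex.abs_re_le_norm z).trans hz.le) (abs_real_inner_le_norm c w)
      (abs_nonneg _) (by norm_num)
  have h2 : |(z ^ 2).re| ≤ 4 := by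
    refine (Complex.abs_re_le_norm _).trans ?_
    rw [norm_pow]
    nlinarith [norm_nonneg z]
  have h3 : ((‖c‖ ^ 2 : ℝ) + 2 * z * (⟪c, w⟫ : ℝ) + z ^ 2 * (‖w‖ ^ 2 : ℝ) : ℂ).re =
      ‖c‖ ^ 2 + 2 * (z.re * ⟪c, w⟫) + (z ^ 2).re * ‖w‖ ^ 2 := by
    rw [Complex.add_re, Complex.add_re, Complex.re_mul_ofReal, Complex.re_mul_ofReal,
      Complex.ofReal_re, show (2 * z).re = 2 * z.re by simp]
    ring
  rw [h3]
  have h4 := (abs_le.1 h1).1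
  have h5 : -(4 * ‖w‖ ^ 2) ≤ (z ^ 2).re * ‖w‖ ^ 2 := by
    nlinarith [(abs_le.1 h2).1, sq_nonneg ‖w‖]
  nlinarith

/-- The derivative of `complexProfile` in `z`. -/
def complexProfileDeriv (N : ℕ) (c w : E) (z : ℂ) : ℂ :=
  ((1 - N / 2 : ℝ) : ℂ) * ((‖c‖ ^ 2 : ℝ) + 2 * z * (⟪c, w⟫ : ℝ) + z ^ 2 * (‖w‖ ^ 2 : ℝ)) ^
    (((1 - N / 2 : ℝ) : ℂ) - 1) * (2 * (⟪c, w⟫ : ℝ) + 2 * z * (‖w‖ ^ 2 : ℝ)) / (2 - N)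

omit [MeasurableSpace E] [BorelSpace E] [FiniteDimensional ℝ E] [Nontrivial E] in
theorem hasDerivAt_complexProfile (N : ℕ) {c w : E} {z : ℂ} (hc : 8 * ‖w‖ < ‖c‖)
    (hz : ‖z‖ < 2) : HasDerivAt (complexProfile N c w) (complexProfileDeriv N c w z) z := by
  have hq : HasDerivAt (fun z : ℂ => ((‖c‖ ^ 2 : ℝ) + 2 * z * (⟪c, w⟫ : ℝ) +
      z ^ 2 * (‖w‖ ^ 2 : ℝ) : ℂ)) (2 * (⟪c, w⟫ : ℝ) + 2 * z * (‖w‖ ^ 2 : ℝ)) z := by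
    have h1 := ((hasDerivAt_id z).const_mul (2 : ℂ)).mul_const ((⟪c, w⟫ : ℝ) : ℂ)
    have h2 := ((hasDerivAt_id z).pow 2).mul_const ((‖w‖ ^ 2 : ℝ) : ℂ)
    convert! (h1.const_add ((‖c‖ ^ 2 : ℝ) : ℂ)).add h2 using 1
    simp
  exact (hq.cpow_const (Or.inl (re_complexProfile_base_pos hc hz))).div_const _

omit [MeasurableSpace E] [BorelSpace E] [FiniteDimensional ℝ E] [Nontrivial E] in
theorem continuousOn_complexProfileDeriv (N : ℕ) (w : E) :
    ContinuousOn (fun p : ℂ × E => complexProfileDeriv N p.2 w p.1)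
      {p | 8 * ‖w‖ < ‖p.2‖ ∧ ‖p.1‖ < 2} := by
  refine ContinuousOn.div_const (ContinuousOn.mul (ContinuousOn.mul continuousOn_const
    (ContinuousOn.cpow_const ?_ ?_)) ?_) _
  · fun_prop
  · rintro ⟨z, c⟩ ⟨h1, h2⟩
    exact Or.inl (re_complexProfile_base_pos h1 h2)
  · fun_prop

omit [FiniteDimensional ℝ E] [Nontrivial E] in
theorem differentiableOn_integral_complexProfile (N : ℕ) (μ : Measure E) [μ.IsAddHaarMeasure]
    {h : E → ℝ} (hh : Continuous h) (hc : HasCompactSupport h) {a w : E}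
    (hs : ∀ y ∈ tsupport h, 8 * ‖w‖ < ‖a - y‖) :
    DifferentiableOn ℂ (fun z => ∫ y, complexProfile N (a - y) w z * h y ∂μ) (ball 0 2) := by
  have hmeas : ∀ z, AEStronglyMeasurable (fun y => complexProfile N (a - y) w z * h y) μ := by
    intro z
    have h1 : Measurable fun y => complexProfile N (a - y) w z := by
      refine Measurable.div_const (Measurable.pow_const ?_ _) _
      exact Continuous.measurable (by fun_prop)
    exact (h1.mul (Complex.continuous_ofReal.comp hh).measurable).aestronglyMeasurable
  have hmeas' : ∀ z, AEStronglyMeasurable (fun y => complexProfileDeriv N (a - y) w z * h y) μ := by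
    intro z
    have h1 : Measurable fun y => complexProfileDeriv N (a - y) w z := by
      refine Measurable.div_const (Measurable.mul (Measurable.const_mul
        (Measurable.pow_const ?_ _) _) ?_) _
      · exact Continuous.measurable (by fun_prop)
      · exact Continuous.measurable (by fun_prop)
    exact (h1.mul (Complex.continuous_ofReal.comp hh).measurable).aestronglyMeasurable
  have hhint : Integrable h μ := hh.integrable_of_hasCompactSupport hc
  intro z₀ hz₀
  rw [mem_ball_zero_iff] at hz₀
  obtain ⟨R, hR1, hR2⟩ := exists_between hz₀
  have hKs : (closedBall (0 : ℂ) R ×ˢ tsupport h).MapsTo (fun p => (p.1, a - p.2))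
      {p : ℂ × E | 8 * ‖w‖ < ‖p.2‖ ∧ ‖p.1‖ < 2} := fun p hp =>
    ⟨hs _ hp.2, (mem_closedBall_zero_iff.1 hp.1).trans_lt hR2⟩
  obtain ⟨B, hB⟩ := ((isCompact_closedBall (0 : ℂ) R).prod hc).exists_bound_of_continuousOn
    ((continuousOn_complexProfileDeriv N w).comp (by fun_prop) hKs)
  have h_int : Integrable (fun y => complexProfile N (a - y) w z₀ * h y) μ := by
    have hco : ContinuousOn (fun y => complexProfile N (a - y) w z₀) (tsupport h) := by
      refine ContinuousOn.div_const (ContinuousOn.cpow_const (by fun_prop) ?_) _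
      exact fun y hy => Or.inl (re_complexProfile_base_pos (hs y hy) hz₀)
    obtain ⟨B', hB'⟩ := hc.isCompact.exists_bound_of_continuousOn hco
    refine (hhint.norm.const_mul B').mono' (hmeas z₀) (Eventually.of_forall fun y => ?_)
    rw [norm_mul, Complex.norm_real]
    by_cases hy : y ∈ tsupport h
    · exact mul_le_mul_of_nonneg_right (hB' y hy) (norm_nonneg _)
    · simp [image_eq_zero_of_notMem_tsupport hy]
  refine (hasDerivAt_integral_of_dominated_loc_of_deriv_le
    (F' := fun z y => complexProfileDeriv N (a - y) w z * h y) (bound := fun y => B * ‖h y‖)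
    (isOpen_ball.mem_nhds (mem_ball_zero_iff.2 hR1)) (Eventually.of_forall hmeas) h_int
    (hmeas' z₀) (Eventually.of_forall fun y z hz => ?_) (hhint.norm.const_mul B)
    (Eventually.of_forall fun y z hz => ?_)).2.differentiableAt.differentiableWithinAt
  · rw [norm_mul, Complex.norm_real]
    by_cases hy : y ∈ tsupport h
    · exact mul_le_mul_of_nonneg_right (hB (z, y) ⟨ball_subset_closedBall hz, hy⟩) (norm_nonneg _)
    · simp [image_eq_zero_of_notMem_tsupport hy]
  · by_cases hy : y ∈ tsupport h
    · exact (hasDerivAt_complexProfile N (hs y hy)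
        ((mem_ball_zero_iff.1 hz).trans hR2)).mul_const _
    · simpa [image_eq_zero_of_notMem_tsupport hy] using hasDerivAt_const z (0 : ℂ)

theorem eq_zero_of_basisLaplacian_eq_zero_of_eventuallyEq (hN : 2 < finrank ℝ E) {u : E → ℝ}
    (hu : ContDiff ℝ 2 u) {a x : E} {r : ℝ} (hΔ : ∀ y ∈ ball a r, basisLaplacian b u y = 0)
    (hz : u =ᶠ[𝓝 a] 0) (hx : ‖x - a‖ < r / 32) : u x = 0 := by
  have hr : 0 < r := by linarith [norm_nonneg (x - a)]
  let μ : Measure E := volume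
  set N := finrank ℝ E with hNdef
  let χ : ContDiffBump a := ⟨r / 2, 3 * r / 4, by linarith, by linarith⟩
  set φ : E → ℝ := fun y => χ y * u y with hφdef
  have hφ : ContDiff ℝ 2 φ := χ.contDiff.mul hu
  have hc : HasCompactSupport φ := χ.hasCompactSupport.mul_right
  have hφu : ∀ y ∈ ball a (r / 2), φ =ᶠ[𝓝 y] u := by
    intro y hy
    filter_upwards [isOpen_ball.mem_nhds hy] with z hz
    rw [hφdef]
    simp [χ.one_of_mem_closedBall (ball_subset_closedBall hz)]
  have hl0 : ∀ y ∈ ball a (r / 2), basisLaplacian b φ y = 0 := fun y hy => by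
    rw [basisLaplacian_congr b (hφu y hy), hΔ y (ball_subset_ball (by linarith) hy)]
  have hsupp : ∀ y ∈ tsupport (basisLaplacian b φ), r / 2 ≤ ‖a - y‖ := by
    intro y hy
    by_contra! hlt
    have : y ∈ ball a (r / 2) := by rwa [mem_ball, dist_comm, dist_eq_norm]
    refine notMem_tsupport_iff_eventuallyEq.2 ?_ hy
    filter_upwards [isOpen_ball.mem_nhds this] with z hz
    exact hl0 z hz
  have hcl : HasCompactSupport (basisLaplacian b φ) :=
    hc.mono' ((subset_tsupport _).trans (tsupport_basisLaplacian_subset b φ))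
  set w := x - a with hw
  set G : ℂ → ℂ := fun z => ∫ y, complexProfile N (a - y) w z * (basisLaplacian b φ y : ℝ) ∂μ
    with hG
  have hGd : DifferentiableOn ℂ G (ball 0 2) :=
    differentiableOn_integral_complexProfile N μ (continuous_basisLaplacian b hφ) hcl
      fun y hy => by linarith [hsupp y hy]
  have hGan : AnalyticOnNhd ℂ G (ball 0 2) := hGd.analyticOnNhd isOpen_ball
  have hGt : ∀ t : ℝ, |t| < 2 → G t = ((N * μ.real (ball 0 1)) * φ (a + t • w) : ℝ) := by
    intro t ht
    have hnt : ‖t • w‖ < r / 16 := by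
      rw [norm_smul, Real.norm_eq_abs]
      nlinarith [norm_nonneg w]
    rw [mul_eq_integral_newtonProfile b μ hN hφ hc (δ := r / 4) (by linarith), hG,
      ← integral_complex_ofReal]
    · refine integral_congr_ae (Eventually.of_forall fun y => ?_)
      simp only
      rw [complexProfile_ofReal, Complex.ofReal_mul, norm_sub_rev y,
        show a + t • w - y = a - y + t • w by abel]
    · intro y hy
      have h1 := hsupp y (subset_tsupport _ hy)
      have h2 : ‖a - y‖ ≤ ‖y - (a + t • w)‖ + ‖t • w‖ := by
        rw [← norm_neg (y - (a + t • w))]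
        refine le_trans (le_of_eq ?_) (norm_sub_le (-(y - (a + t • w))) (t • w))
        congr 1
        abel
      linarith
  have hG0 : ∃ᶠ z in 𝓝[≠] (0 : ℂ), G z = 0 := by
    have h1 : ∀ᶠ t : ℝ in 𝓝 (0 : ℝ), G (t : ℂ) = 0 := by
      have h2 : Tendsto (fun t : ℝ => a + t • w) (𝓝 0) (𝓝 a) := by
        have : Continuous fun t : ℝ => a + t • w := by fun_prop
        simpa using this.tendsto 0
      filter_upwards [h2.eventually hz, ball_mem_nhds (0 : ℝ) (by norm_num : (0 : ℝ) < 2)]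
        with t ht1 ht2
      rw [hGt t (by simpa using ht2), hφdef]
      simp only [ht1]
      simp
    have h3 : ∃ᶠ t : ℝ in 𝓝[≠] (0 : ℝ), G (t : ℂ) = 0 :=
      (h1.filter_mono nhdsWithin_le_nhds).frequently
    have h4 : Tendsto (fun t : ℝ => (t : ℂ)) (𝓝[≠] 0) (𝓝[≠] 0) := by
      refine tendsto_nhdsWithin_iff.2 ⟨?_, ?_⟩
      · simpa using (Complex.continuous_ofReal.tendsto 0).mono_left nhdsWithin_le_nhds
      · filter_upwards [self_mem_nhdsWithin] with t ht
        simpa using ht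
    exact h4.frequently h3
  have hG1 : G 1 = 0 :=
    hGan.eqOn_zero_of_preconnected_of_frequently_eq_zero (convex_ball _ _).isPreconnected
      (by simp) hG0 (by simp)
  have h1 := hGt 1 (by norm_num)
  rw [Complex.ofReal_one, hG1, eq_comm, Complex.ofReal_eq_zero, one_smul,
    show a + w = x by rw [hw]; abel] at h1
  have hpos : (N : ℝ) * μ.real (ball 0 1) ≠ 0 := by
    refine mul_ne_zero (by positivity) ?_
    exact (ENNReal.toReal_pos (measure_ball_pos μ 0 one_pos).ne' measure_ball_lt_top.ne).ne'
  have h2 := (mul_eq_zero.1 h1).resolve_left hpos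
  rwa [(hφu x (by rw [mem_ball, dist_eq_norm]; linarith)).eq_of_nhds] at h2

/-- **Unique continuation** for harmonic functions in dimension `> 2`. -/
theorem eqOn_zero_of_isPreconnected_of_basisLaplacian_eq_zero (hN : 2 < finrank ℝ E) {u : E → ℝ}
    (hu : ContDiff ℝ 2 u) {Ω s : Set E} (hΩ : IsOpen Ω) (hΔ : ∀ y ∈ Ω, basisLaplacian b u y = 0)
    (hs : IsPreconnected s) (hsΩ : s ⊆ Ω) {a : E} (ha : a ∈ s) (hz : u =ᶠ[𝓝 a] 0) :
    ∀ x ∈ s, u x = 0 := by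
  have hsub : s ⊆ {x | ∀ᶠ y in 𝓝 x, u y = 0} := by
    refine hs.subset_of_closure_inter_subset isOpen_setOfPred_eventually_nhds ⟨a, ha, hz⟩ ?_
    rintro x ⟨hxc, hxs⟩
    obtain ⟨r, hr, hrΩ⟩ := Metric.isOpen_iff.1 hΩ x (hsΩ hxs)
    obtain ⟨c, hc, hxc⟩ := Metric.mem_closure_iff.1 hxc (r / 128) (by linarith)
    filter_upwards [ball_mem_nhds x (by linarith : 0 < r / 128)] with y hy
    refine eq_zero_of_basisLaplacian_eq_zero_of_eventuallyEq b hN hu (a := c) (r := r / 2)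
      (fun z hz => hΔ z (hrΩ ?_)) hc ?_
    · rw [mem_ball] at hz ⊢
      linarith [dist_triangle z c x, dist_comm x c]
    · rw [← dist_eq_norm]
      rw [mem_ball] at hy
      linarith [dist_triangle y x c]
  exact fun x hx => (hsub hx).self_of_nhds

end UniqueContinuation

end Inner

end Potential

section SliceIntegral
open Set Filter Topology Module Metric

variable {E F P : Type*} [NormedAddCommGroup E] [NormedSpace ℝ E] [MeasurableSpace E]
  [BorelSpace E] [NormedAddCommGroup F] [NormedSpace ℝ F]
  [NormedAddCommGroup P] [NormedSpace ℝ P]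

/-- The convolution-type integral `∫ κ(y) g(x + A y) dμ(y)` along the range of `A`. -/
def sliceIntegral (μ : Measure E) (A : E →L[ℝ] P) (κ : E → ℝ) (g : P → F) (x : P) : F :=
  ∫ y, κ y • g (x + A y) ∂μ

variable {μ : Measure E} {A : E →L[ℝ] P} {κ : E → ℝ} {g : P → F}

omit [MeasurableSpace E] [BorelSpace E] [NormedSpace ℝ F] in
theorem hasCompactSupport_slice (hA : IsClosedEmbedding A) (hc : HasCompactSupport g) (x : P) :
    HasCompactSupport fun y => g (x + A y) :=
  hc.comp_isClosedEmbedding ((Homeomorph.addLeft x).isClosedEmbedding.comp hA)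

theorem integrable_slice (hA : IsClosedEmbedding A) (hκ : LocallyIntegrable κ μ)
    (hg : Continuous g) (hc : HasCompactSupport g) (x : P) :
    Integrable (fun y => κ y • g (x + A y)) μ :=
  hκ.integrable_smul_right_of_hasCompactSupport (hg.comp (by fun_prop))
    (hasCompactSupport_slice hA hc x)

variable [FiniteDimensional ℝ P]

omit [MeasurableSpace E] [BorelSpace E] [NormedSpace ℝ F] in
theorem exists_isCompact_slice_eq_zero (hA : IsClosedEmbedding A) (hc : HasCompactSupport g)
    (x₀ : P) : ∃ k : Set E, IsCompact k ∧ ∀ x ∈ ball x₀ 1, ∀ y ∉ k, x + A y ∉ tsupport g := by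
  have : ProperSpace P := FiniteDimensional.proper ℝ P
  refine ⟨A ⁻¹' ((fun p : P × P => p.1 - p.2) '' (tsupport g ×ˢ closedBall x₀ 1)),
    hA.isCompact_preimage ((hc.isCompact.prod (isCompact_closedBall x₀ 1)).image (by fun_prop)),
    fun x hx y hy hmem => hy ⟨(x + A y, x), ⟨hmem, ball_subset_closedBall hx⟩, ?_⟩⟩
  simp

theorem hasFDerivAt_sliceIntegral (hA : IsClosedEmbedding A) (hκ : LocallyIntegrable κ μ)
    (hg : ContDiff ℝ 1 g) (hc : HasCompactSupport g) (x₀ : P) :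
    HasFDerivAt (sliceIntegral μ A κ g) (sliceIntegral μ A κ (fderiv ℝ g) x₀) x₀ := by
  obtain ⟨k, hk, hk0⟩ := exists_isCompact_slice_eq_zero hA (hc.fderiv ℝ) x₀
  have hg' := hg.continuous_fderiv one_ne_zero
  obtain ⟨C, hC⟩ := (hc.fderiv ℝ).exists_bound_of_continuous hg'
  have h_int := fun x => integrable_slice hA hκ hg.continuous hc x
  refine hasFDerivAt_integral_of_dominated_of_fderiv_le
    (F := fun x y => κ y • g (x + A y)) (F' := fun x y => κ y • fderiv ℝ g (x + A y))
    (bound := k.indicator fun y => ‖κ y‖ * C) (ball_mem_nhds x₀ one_pos)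
    (Eventually.of_forall fun x => (h_int x).aestronglyMeasurable) (h_int x₀)
    (integrable_slice hA hκ hg' (hc.fderiv ℝ) x₀).aestronglyMeasurable
    (Eventually.of_forall fun y x hx => ?_) ?_ (Eventually.of_forall fun y x hx => ?_)
  · by_cases hy : y ∈ k
    · rw [indicator_of_mem hy, norm_smul]
      exact mul_le_mul_of_nonneg_left (hC _) (norm_nonneg _)
    · rw [indicator_of_notMem hy, image_eq_zero_of_notMem_tsupport (hk0 x hx y hy), smul_zero,
        norm_zero]
  · exact (integrable_indicator_iff hk.measurableSet).2
      ((hκ.integrableOn_isCompact hk).norm.mul_const C)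
  · have h1 := (hg.differentiable one_ne_zero (x + A y)).hasFDerivAt
    exact ((hasFDerivAt_comp_add_right (f := g) (A y)).2 h1).const_smul (κ y)

theorem fderiv_sliceIntegral_apply [CompleteSpace F] (hA : IsClosedEmbedding A)
    (hκ : LocallyIntegrable κ μ) (hg : ContDiff ℝ 1 g) (hc : HasCompactSupport g) (x v : P) :
    fderiv ℝ (sliceIntegral μ A κ g) x v = sliceIntegral μ A κ (fun z => fderiv ℝ g z v) x := by
  rw [(hasFDerivAt_sliceIntegral hA hκ hg hc x).fderiv, sliceIntegral,
    ContinuousLinearMap.integral_apply (integrable_slice hA hκ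
      (hg.continuous_fderiv one_ne_zero) (hc.fderiv ℝ) x)]
  rfl

theorem contDiff_sliceIntegral (hA : IsClosedEmbedding A) (hκ : LocallyIntegrable κ μ) {k : ℕ}
    (hg : ContDiff ℝ k g) (hc : HasCompactSupport g) : ContDiff ℝ k (sliceIntegral μ A κ g) := by
  rw [contDiff_iff_contDiffAt]
  intro x₀
  obtain ⟨K, hK, hK0⟩ := exists_isCompact_slice_eq_zero hA hc x₀
  have := contDiffOn_convolution_right_with_param_comp (𝕜 := ℝ) (μ := μ) (n := (k : ℕ∞))
    (ContinuousLinearMap.lsmul ℝ ℝ) (s := ball x₀ 1) (v := fun _ => (0 : E)) contDiffOn_const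
    (f := κ) (g := fun x z => g (x - A z)) (k := -K) isOpen_ball hK.neg ?_ hκ ?_
  · refine ContDiffOn.contDiffAt (s := ball x₀ 1) ?_ (ball_mem_nhds x₀ one_pos)
    refine this.congr fun x _ => ?_
    simp [convolution_def, sliceIntegral]
  · intro x z hx hz
    have := hK0 x hx (-z) (by simpa using hz)
    rw [map_neg, ← sub_eq_add_neg] at this
    exact image_eq_zero_of_notMem_tsupport this
  · refine ContDiff.contDiffOn ?_
    exact hg.comp (contDiff_fst.sub (A.contDiff.comp contDiff_snd))

end SliceIntegral

section PartialDerivatives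

variable {E F : Type} [NormedAddCommGroup E] [NormedSpace ℝ E] [NormedAddCommGroup F]
  [NormedSpace ℝ F] {f : Mn n m → E}

theorem contDiff_pd {k l : ℕ} (hf : ContDiff ℝ k f) (h : l + 1 ≤ k) (j : Fin n)
    (s : Fin (m + 1)) : ContDiff ℝ l (pd f j s) :=
  (hf.fderiv_right (m := l) (by exact_mod_cast h)).clm_apply contDiff_const

theorem hasCompactSupport_pd (hf : HasCompactSupport f) (j : Fin n) (s : Fin (m + 1)) :
    HasCompactSupport (pd f j s) :=
  hf.fderiv_apply ℝ _

theorem fderiv_fderiv_apply_comm {P : Type*} [NormedAddCommGroup P] [NormedSpace ℝ P] {f : P → E}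
    (hf : ContDiff ℝ 2 f) (x v w : P) :
    fderiv ℝ (fun z => fderiv ℝ f z v) x w = fderiv ℝ (fun z => fderiv ℝ f z w) x v := by
  have hd : DifferentiableAt ℝ (fderiv ℝ f) x :=
    (hf.fderiv_right (m := 1) (by norm_num)).differentiable one_ne_zero x
  have hs : IsSymmSndFDerivAt ℝ f x := hf.contDiffAt.isSymmSndFDerivAt (by simp)
  rw [fderiv_clm_apply hd (differentiableAt_const v), fderiv_clm_apply hd (differentiableAt_const w)]
  simpa using hs.eq w v

theorem pd_comm (hf : ContDiff ℝ 2 f) (i j : Fin n) (s t : Fin (m + 1)) (x : Mn n m) :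
    pd (pd f i s) j t x = pd (pd f j t) i s x :=
  fderiv_fderiv_apply_comm hf x _ _

theorem pd_clm_comp (L : E →L[ℝ] F) (j : Fin n) (s : Fin (m + 1)) {x : Mn n m}
    (hf : DifferentiableAt ℝ f x) : pd (fun z => L (f z)) j s x = L (pd f j s x) := by
  have h : HasFDerivAt (fun z => L (f z)) (L.comp (fderiv ℝ f x)) x :=
    L.hasFDerivAt.comp x hf.hasFDerivAt
  rw [pd, h.fderiv]
  rfl

theorem pd_sum {ι : Type*} (u : Finset ι) {f : ι → Mn n m → E} (j : Fin n) (s : Fin (m + 1))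
    {x : Mn n m} (hf : ∀ i ∈ u, DifferentiableAt ℝ (f i) x) :
    pd (fun z => ∑ i ∈ u, f i z) j s x = ∑ i ∈ u, pd (f i) j s x := by
  simp only [pd, fderiv_fun_sum hf, _root_.sum_apply]

end PartialDerivatives

namespace HCAlg

variable (H : HCAlg 𝔸 m)

theorem conj_v {s : Fin (m + 1)} (hs : s ≠ 0) : H.conj (H.v s) = -H.v s :=
  eq_neg_of_add_eq_zero_right (H.v_trace s hs)

theorem v_mul_v_self {s : Fin (m + 1)} (hs : s ≠ 0) : H.mul (H.v s) (H.v s) = -H.one := by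
  rw [← H.v_norm s hs, H.conj_v hs, map_neg, neg_neg]

theorem mul_mul_add_mul_mul (a b c : 𝔸) :
    H.mul a (H.mul b c) + H.mul b (H.mul a c) = H.mul (H.mul a b + H.mul b a) c := by
  have h := H.alt_left (a + b) c
  simp only [map_add, LinearMap.add_apply, H.alt_left a c, H.alt_left b c] at h ⊢
  rw [← sub_eq_zero] at h ⊢
  rw [← h]
  abel

theorem conj_v_mul_v_mul_add (s t : Fin (m + 1)) (a : 𝔸) :
    H.mul (H.conj (H.v s)) (H.mul (H.v t) a) + H.mul (H.conj (H.v t)) (H.mul (H.v s) a)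
      = if s = t then (2 : ℝ) • a else 0 := by
  by_cases hs : s = 0
  · subst hs
    by_cases ht : t = 0
    · subst ht
      simp [H.v_zero, H.conj_one, H.one_mul', two_smul]
    · simp [H.v_zero, H.conj_one, H.one_mul', H.conj_v ht, Ne.symm ht]
  by_cases ht : t = 0
  · subst ht
    simp [H.v_zero, H.conj_one, H.one_mul', H.conj_v hs, hs]
  rw [H.conj_v hs, H.conj_v ht]
  split_ifs with hst
  · subst hst
    simp [H.alt_left, H.v_mul_v_self hs, H.one_mul', two_smul]
  · have h := H.mul_mul_add_mul_mul (H.v s) (H.v t) a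
    rw [H.v_anticomm s t hs ht hst, neg_add_cancel, map_zero, LinearMap.zero_apply] at h
    simp only [map_neg, LinearMap.neg_apply, ← neg_add, h, neg_zero]

/-- Left multiplication as a continuous linear map. -/
def mulCLM (a : 𝔸) : 𝔸 →L[ℝ] 𝔸 :=
  haveI := H.findim
  LinearMap.toContinuousLinearMap (H.mul a)

@[simp] theorem mulCLM_apply (a b : 𝔸) : H.mulCLM a b = H.mul a b := rfl

end HCAlg

theorem dconj_dbar (H : HCAlg 𝔸 m) {f : Mn n m → 𝔸} (hf : ContDiff ℝ 2 f) (j : Fin n)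
    (x : Mn n m) : dconj H (dbar H f j) j x = lap f j x := by
  have hd : ∀ t y, DifferentiableAt ℝ (pd f j t) y := fun t y =>
    (contDiff_pd (k := 2) (l := 1) hf (by norm_num) j t).differentiable (by norm_num) y
  have h1 : ∀ s, pd (dbar H f j) j s x = ∑ t, H.mul (H.v t) (pd (pd f j t) j s x) := by
    intro s
    have : dbar H f j = fun z => ∑ t, H.mulCLM (H.v t) (pd f j t z) := rfl
    rw [this, pd_sum (f := fun t z => H.mulCLM (H.v t) (pd f j t z)) _ _ _ fun t _ =>
      (H.mulCLM _).differentiableAt.comp x (hd t x)]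
    exact Finset.sum_congr rfl fun t _ => pd_clm_comp (H.mulCLM (H.v t)) j s (hd t x)
  have h2 : dconj H (dbar H f j) j x = ∑ s, ∑ t,
      H.mul (H.conj (H.v s)) (H.mul (H.v t) (pd (pd f j t) j s x)) := by
    simp only [dconj, h1, map_sum]
  have h3 : dconj H (dbar H f j) j x = ∑ s, ∑ t,
      H.mul (H.conj (H.v t)) (H.mul (H.v s) (pd (pd f j t) j s x)) := by
    rw [h2, Finset.sum_comm]
    exact Finset.sum_congr rfl fun s _ => Finset.sum_congr rfl fun t _ => by rw [pd_comm hf]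
  have h4 : (2 : ℝ) • dconj H (dbar H f j) j x = (2 : ℝ) • lap f j x := by
    rw [two_smul]
    nth_rw 1 [h2]
    rw [h3, ← Finset.sum_add_distrib, lap, Finset.smul_sum]
    refine Finset.sum_congr rfl fun s _ => ?_
    rw [← Finset.sum_add_distrib]
    simp [H.conj_v_mul_v_mul_add]
  exact smul_right_injective 𝔸 (two_ne_zero' ℝ) h4

theorem lap_eq_zero_of_dbar_eq_zero (H : HCAlg 𝔸 m) {f : Mn n m → 𝔸} (hf : ContDiff ℝ 2 f)
    {U : Set (Mn n m)} (hU : IsOpen U) {j : Fin n} (h : ∀ x ∈ U, dbar H f j x = 0) :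
    ∀ x ∈ U, lap f j x = 0 := by
  intro x hx
  have h0 : dbar H f j =ᶠ[nhds x] fun _ => 0 := Filter.eventually_of_mem (hU.mem_nhds hx) h
  simp [← dconj_dbar H hf, dconj, pd, h0.fderiv_eq]

section CauchyTransform
open Set Filter Topology Module Metric
open scoped RealInnerProductSpace

/-- The inclusion of `ℝ^{m+1}` into `M^n` as the `p`-th block of coordinates. -/
def blockEmb (p : Fin n) : EuclideanSpace ℝ (Fin (m + 1)) →L[ℝ] Mn n m :=
  (ContinuousLinearMap.single ℝ (fun _ : Fin n => Fin (m + 1) → ℝ) p).comp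
    (EuclideanSpace.equiv (Fin (m + 1)) ℝ).toContinuousLinearMap

theorem blockEmb_apply (p : Fin n) (y : EuclideanSpace ℝ (Fin (m + 1))) :
    blockEmb p y = Pi.single p (WithLp.ofLp y) := rfl

theorem blockEmb_basisFun (p : Fin n) (t : Fin (m + 1)) :
    blockEmb p (EuclideanSpace.basisFun (Fin (m + 1)) ℝ t) = Pi.single p (Pi.single t 1) := by
  rw [blockEmb_apply, EuclideanSpace.basisFun_apply]
  rfl

theorem isClosedEmbedding_blockEmb (p : Fin n) :
    IsClosedEmbedding (blockEmb p : EuclideanSpace ℝ (Fin (m + 1)) → Mn n m) :=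
  LinearMap.isClosedEmbedding_of_injective (f := (blockEmb p).toLinearMap) <|
    LinearMap.ker_eq_bot.2 fun _ _ h => WithLp.ofLp_injective 2 (Pi.single_injective p h)

theorem update_add_eq (x : Mn n m) (p : Fin n) (y : EuclideanSpace ℝ (Fin (m + 1))) :
    Function.update x p (WithLp.ofLp y + x p) = x + blockEmb p y := by
  ext j s
  rw [blockEmb_apply]
  by_cases h : j = p
  · subst h
    simp [add_comm]
  · simp [h]

theorem usigma_eq {N : ℕ} (hN : N ≠ 0) :
    usigma N = N * volume.real (ball (0 : EuclideanSpace ℝ (Fin N)) 1) := by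
  have : Nonempty (Fin N) := Fin.pos_iff_nonempty.1 (Nat.pos_of_ne_zero hN)
  have hN' : (N : ℝ) / 2 ≠ 0 := by positivity
  have hG : 0 < Real.Gamma ((N : ℝ) / 2) := Real.Gamma_pos_of_pos (by positivity)
  rw [Measure.real, EuclideanSpace.volume_ball, Fintype.card_fin, Real.Gamma_add_one hN',
    ENNReal.ofReal_one, one_pow, one_mul, ENNReal.toReal_ofReal (by positivity), usigma,
    Real.sqrt_eq_rpow, ← Real.rpow_natCast, ← Real.rpow_mul Real.pi_pos.le, one_div_mul_eq_div]
  have : (N : ℝ) ≠ 0 := by positivity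
  field_simp

theorem usigma_pos {N : ℕ} (hN : N ≠ 0) : 0 < usigma N := by
  have : 0 < (N : ℝ) := by positivity
  have := Real.Gamma_pos_of_pos (half_pos this)
  unfold usigma
  positivity

theorem mul_cauchyE (H : HCAlg 𝔸 m) (y : EuclideanSpace ℝ (Fin (m + 1))) (a : 𝔸) :
    H.mul (CauchyE H (WithLp.ofLp y)) a = ∑ t, H.mulCLM (H.conj (H.v t)) ((usigma (m + 1))⁻¹ •
      singKernel (EuclideanSpace.basisFun (Fin (m + 1)) ℝ t) y • a) := by
  have h : enormM (WithLp.ofLp y) = ‖y‖ := by simp [enormM, EuclideanSpace.norm_eq]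
  simp only [CauchyE, embM, h, map_sum, map_smul, LinearMap.smul_apply, LinearMap.sum_apply,
    Finset.smul_sum, HCAlg.mulCLM_apply, singKernel, finrank_euclideanSpace_fin, smul_smul]
  refine Finset.sum_congr rfl fun t _ => ?_
  congr 1
  rw [EuclideanSpace.inner_basisFun_real, mul_inv]
  ring

theorem tsol_eq (H : HCAlg 𝔸 m) (hn : 0 < n) {g : Mn n m → 𝔸} (hg : Continuous g)
    (hc : HasCompactSupport g) (x : Mn n m) :
    Tsol H hn g x = -∑ t, H.mulCLM (H.conj (H.v t)) ((usigma (m + 1))⁻¹ •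
      sliceIntegral volume (blockEmb ⟨0, hn⟩)
        (singKernel (EuclideanSpace.basisFun (Fin (m + 1)) ℝ t)) g x) := by
  have := H.findim
  have := FiniteDimensional.complete ℝ 𝔸
  have hi : ∀ t, Integrable (fun y => (usigma (m + 1))⁻¹ •
      singKernel (EuclideanSpace.basisFun (Fin (m + 1)) ℝ t) y • g (x + blockEmb ⟨0, hn⟩ y)) :=
    fun t => (integrable_slice (isClosedEmbedding_blockEmb _)
      (locallyIntegrable_singKernel volume _) hg hc x).smul _
  rw [Tsol, ← integral_add_right_eq_self _ (x ⟨0, hn⟩),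
    ← (PiLp.volume_preserving_ofLp (Fin (m + 1))).integral_comp
      (MeasurableEquiv.toLp 2 (Fin (m + 1) → ℝ)).symm.measurableEmbedding]
  simp only [add_sub_cancel_right, update_add_eq, mul_cauchyE]
  rw [integral_finsetSum _ fun t _ => (H.mulCLM _).integrable_comp (hi t)]
  congr 1
  refine Finset.sum_congr rfl fun t _ => ?_
  rw [ContinuousLinearMap.integral_comp_comm _ (hi t), integral_smul]
  rfl

theorem contDiff_tsol (H : HCAlg 𝔸 m) (hn : 0 < n) {k : ℕ} {g : Mn n m → 𝔸}
    (hg : ContDiff ℝ k g) (hc : HasCompactSupport g) : ContDiff ℝ k (Tsol H hn g) := by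
  have := H.findim
  have := FiniteDimensional.complete ℝ 𝔸
  rw [funext (tsol_eq H hn hg.continuous hc)]
  exact (ContDiff.sum fun t _ => (H.mulCLM _).contDiff.comp ((contDiff_sliceIntegral
    (isClosedEmbedding_blockEmb _) (locallyIntegrable_singKernel volume _) hg hc).const_smul _)).neg

theorem pd_tsol (H : HCAlg 𝔸 m) (hn : 0 < n) {g : Mn n m → 𝔸} (hg : ContDiff ℝ 1 g)
    (hc : HasCompactSupport g) (i : Fin n) (s : Fin (m + 1)) (x : Mn n m) :
    pd (Tsol H hn g) i s x = Tsol H hn (pd g i s) x := by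
  have := H.findim
  have := FiniteDimensional.complete ℝ 𝔸
  rw [tsol_eq H hn (contDiff_pd (k := 1) (l := 0) hg le_rfl i s).continuous
    (hasCompactSupport_pd hc i s), funext (tsol_eq H hn hg.continuous hc)]
  have hd := fun t => (hasFDerivAt_sliceIntegral (isClosedEmbedding_blockEmb ⟨0, hn⟩)
    (locallyIntegrable_singKernel volume (EuclideanSpace.basisFun (Fin (m + 1)) ℝ t))
    hg hc x).differentiableAt
  have hd' : ∀ t, DifferentiableAt ℝ (fun z => (usigma (m + 1))⁻¹ • sliceIntegral volume
      (blockEmb ⟨0, hn⟩) (singKernel (EuclideanSpace.basisFun (Fin (m + 1)) ℝ t)) g z) x :=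
    fun t => (hd t).const_smul (usigma (m + 1))⁻¹
  rw [pd, fderiv_fun_neg, _root_.neg_apply]
  congr 1
  change pd _ i s x = _
  rw [pd_sum _ _ _ fun t _ => (H.mulCLM _).differentiableAt.fun_comp' x (hd' t)]
  refine Finset.sum_congr rfl fun t _ => ?_
  rw [pd_clm_comp (H.mulCLM _) i s (hd' t)]
  congr 1
  rw [pd, fderiv_fun_const_smul (hd t), _root_.smul_apply,
    fderiv_sliceIntegral_apply (isClosedEmbedding_blockEmb _)
      (locallyIntegrable_singKernel volume _) hg hc]
  rfl

end CauchyTransform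

section FundamentalSolution
open Set Filter Topology Module Metric

theorem exists_hasDerivAt_rpow_neg_half {N : ℕ} (hN : 2 ≤ N) :
    ∃ L : ℝ → ℝ, ∀ ρ, 0 < ρ → HasDerivAt L (ρ ^ (-((N : ℝ) / 2)) / 2) ρ := by
  obtain rfl | h := hN.eq_or_lt
  · refine ⟨fun ρ => Real.log ρ / 2, fun ρ hρ => ?_⟩
    convert! (Real.hasDerivAt_log hρ.ne').div_const 2 using 2
    norm_num [Real.rpow_neg_one]
  · exact ⟨newtonProfile N, fun ρ hρ => hasDerivAt_newtonProfile h hρ⟩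

variable {E P F : Type*} [NormedAddCommGroup E] [NormedAddCommGroup P] [NormedSpace ℝ P]
  [NormedAddCommGroup F] [NormedSpace ℝ F]

theorem fderiv_slice_apply [NormedSpace ℝ E] (A : E →L[ℝ] P) {h : P → F}
    (hh : Differentiable ℝ h) (x : P) (y v : E) :
    fderiv ℝ (fun y => h (x + A y)) y v = fderiv ℝ h (x + A y) (A v) := by
  have h1 : HasFDerivAt (fun y => h (x + A y)) ((fderiv ℝ h (x + A y)).comp A) y :=
    (hh (x + A y)).hasFDerivAt.comp y (A.hasFDerivAt.const_add x)
  rw [h1.fderiv, ContinuousLinearMap.comp_apply]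

theorem basisLaplacian_slice [InnerProductSpace ℝ E] {ι : Type*} [Fintype ι]
    (b : OrthonormalBasis ι ℝ E) (A : E →L[ℝ] P) {h : P → F} (hh : ContDiff ℝ 2 h)
    (x : P) (y : E) : basisLaplacian b (fun y => h (x + A y)) y =
      ∑ i, fderiv ℝ (fun z => fderiv ℝ h z (A (b i))) (x + A y) (A (b i)) := by
  refine Finset.sum_congr rfl fun i _ => ?_
  have h1 : ContDiff ℝ 1 fun z => fderiv ℝ h z (A (b i)) :=
    (hh.fderiv_right (m := 1) (by norm_num)).clm_apply contDiff_const
  rw [← fderiv_slice_apply A (h1.differentiable one_ne_zero)]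
  simp only [fderiv_slice_apply A (hh.differentiable two_ne_zero)]

end FundamentalSolution

section DiracOfCauchyTransform
open Set Filter Topology Module Metric

theorem tendsto_integral_profile_smul_pd {F : Type} [NormedAddCommGroup F] [NormedSpace ℝ F]
    {L : ℝ → ℝ} (hL : ∀ ρ, 0 < ρ → HasDerivAt L (ρ ^ (-(((m + 1 : ℕ) : ℝ) / 2)) / 2) ρ)
    {h : Mn n m → F} (hh : ContDiff ℝ 1 h) (hc : HasCompactSupport h) (p : Fin n)
    (t : Fin (m + 1)) (x : Mn n m) :
    Tendsto (fun ε => ∫ y : EuclideanSpace ℝ (Fin (m + 1)),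
        L (‖y‖ ^ 2 + ε) • pd h p t (x + blockEmb p y)) (𝓝[>] 0)
      (𝓝 (-sliceIntegral volume (blockEmb p)
        (singKernel (EuclideanSpace.basisFun (Fin (m + 1)) ℝ t)) h x)) := by
  have hc' := hasCompactSupport_slice (isClosedEmbedding_blockEmb p) hc x
  refine (tendsto_integral_regKernel volume (EuclideanSpace.basisFun (Fin (m + 1)) ℝ t)
    (hh.continuous.comp (by fun_prop)) hc').neg.congr' ?_
  filter_upwards [self_mem_nhdsWithin] with ε hε
  rw [← integral_profile_smul_fderiv volume (by simpa using hL) hε _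
    (hh.comp (contDiff_const.add (blockEmb p).contDiff)) hc']
  simp only [Function.comp_def]
  simp only [fderiv_slice_apply _ (hh.differentiable one_ne_zero), blockEmb_basisFun, pd]

theorem dbar_dconj (H : HCAlg 𝔸 m) {f : Mn n m → 𝔸} (hf : ContDiff ℝ 2 f) (i p : Fin n)
    (x : Mn n m) : dbar H (dconj H f p) i x = ∑ s, ∑ t,
      (H.mulCLM (H.v s)).comp (H.mulCLM (H.conj (H.v t))) (pd (pd f i s) p t x) := by
  have hd : ∀ t, DifferentiableAt ℝ (pd f p t) x := fun t =>
    (contDiff_pd (k := 2) (l := 1) hf (by norm_num) p t).differentiable (by norm_num) x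
  refine Finset.sum_congr rfl fun s _ => ?_
  have h1 : dconj H f p = fun z => ∑ t, H.mulCLM (H.conj (H.v t)) (pd f p t z) := rfl
  rw [h1, pd_sum (f := fun t z => H.mulCLM (H.conj (H.v t)) (pd f p t z)) _ _ _ fun t _ =>
    (H.mulCLM _).differentiableAt.fun_comp' x (hd t), map_sum]
  refine Finset.sum_congr rfl fun t _ => ?_
  rw [pd_clm_comp (H.mulCLM _) i s (hd t), pd_comm hf p i]
  rfl

/-- The Cauchy transform solves the inhomogeneous Cauchy–Riemann equations under the
compatibility conditions. -/
theorem dbar_tsol (H : HCAlg 𝔸 m) (hn : 0 < n) {g₁ u : Mn n m → 𝔸} (hg : ContDiff ℝ 2 g₁)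
    (hgc : HasCompactSupport g₁) (hu : ContDiff ℝ 2 u) (huc : HasCompactSupport u) (i : Fin n)
    (hcompat : ∀ x, dbar H (dconj H g₁ ⟨0, hn⟩) i x = lap u ⟨0, hn⟩ x) (x : Mn n m) :
    dbar H (Tsol H hn g₁) i x = u x := by
  have := H.findim
  have := FiniteDimensional.complete ℝ 𝔸
  set p : Fin n := ⟨0, hn⟩
  have hA := isClosedEmbedding_blockEmb (m := m) p
  obtain ⟨L, hL⟩ := exists_hasDerivAt_rpow_neg_half (N := m + 1) (by have := H.hm; omega)
  have hL' : ∀ ρ, 0 < ρ → HasDerivAt L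
      (ρ ^ (-((finrank ℝ (EuclideanSpace ℝ (Fin (m + 1))) : ℝ) / 2)) / 2) ρ := by
    simpa using hL
  have h1 : ∀ s, ContDiff ℝ 1 (pd g₁ i s) := fun s =>
    contDiff_pd (k := 2) (l := 1) hg le_rfl i s
  have h1c : ∀ s, HasCompactSupport (pd g₁ i s) := fun s => hasCompactSupport_pd hgc i s
  have hlim := tendsto_finsetSum Finset.univ fun s _ => tendsto_finsetSum Finset.univ
    fun t _ => (((H.mulCLM (H.v s)).comp (H.mulCLM (H.conj (H.v t)))).continuous.tendsto _).comp
      ((tendsto_integral_profile_smul_pd hL (h1 s) (h1c s) p t x).const_smul (usigma (m + 1))⁻¹)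
  have hlim' := (tendsto_integral_profile_smul_laplacian
    (EuclideanSpace.basisFun (Fin (m + 1)) ℝ) volume hL'
    (hu.comp (contDiff_const.add (blockEmb p).contDiff))
    (hasCompactSupport_slice hA huc x)).const_smul (usigma (m + 1))⁻¹
  rw [finrank_euclideanSpace_fin, ← usigma_eq m.succ_ne_zero,
    inv_smul_smul₀ (usigma_pos m.succ_ne_zero).ne', Function.comp_apply, map_zero, add_zero]
    at hlim'
  have hval : dbar H (Tsol H hn g₁) i x = ∑ s, ∑ t,
      (H.mulCLM (H.v s)).comp (H.mulCLM (H.conj (H.v t))) ((usigma (m + 1))⁻¹ •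
        -sliceIntegral volume (blockEmb p)
          (singKernel (EuclideanSpace.basisFun (Fin (m + 1)) ℝ t)) (pd g₁ i s) x) := by
    refine Finset.sum_congr rfl fun s _ => ?_
    rw [pd_tsol H hn (hg.of_le one_le_two) hgc, tsol_eq H hn (h1 s).continuous (h1c s)]
    simp only [smul_neg, map_neg, map_sum, Finset.sum_neg_distrib]
    rfl
  rw [hval]
  refine tendsto_nhds_unique (hlim.congr' ?_) hlim'
  filter_upwards [self_mem_nhdsWithin] with ε hε
  have hLc : Continuous fun y : EuclideanSpace ℝ (Fin (m + 1)) => L (‖y‖ ^ 2 + ε) :=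
    continuous_iff_continuousAt.2 fun y => (hasFDerivAt_profile hL' hε y).continuousAt
  have hi : ∀ s t, Integrable fun y : EuclideanSpace ℝ (Fin (m + 1)) =>
      L (‖y‖ ^ 2 + ε) • pd (pd g₁ i s) p t (x + blockEmb p y) := fun s t => (hLc.smul
      ((contDiff_pd (k := 1) (l := 0) (h1 s) le_rfl p t).continuous.comp
        (by fun_prop))).integrable_of_hasCompactSupport
      (hasCompactSupport_slice hA (hasCompactSupport_pd (h1c s) p t) x).smul_left
  have hlap : ∀ y, basisLaplacian (EuclideanSpace.basisFun (Fin (m + 1)) ℝ)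
      (u ∘ fun y => x + blockEmb p y) y = ∑ s, ∑ t,
        (H.mulCLM (H.v s)).comp (H.mulCLM (H.conj (H.v t)))
          (pd (pd g₁ i s) p t (x + blockEmb p y)) := by
    intro y
    rw [Function.comp_def, basisLaplacian_slice _ _ hu, ← dbar_dconj H hg, hcompat]
    simp only [blockEmb_basisFun]
    rfl
  simp only [hlap, Finset.smul_sum, ← map_smul]
  rw [integral_finsetSum _ fun s _ => integrable_finsetSum _ fun t _ =>
    ContinuousLinearMap.integrable_comp _ (hi s t), Finset.smul_sum]
  refine Finset.sum_congr rfl fun s _ => ?_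
  rw [integral_finsetSum _ fun t _ => ContinuousLinearMap.integrable_comp _ (hi s t),
    Finset.smul_sum]
  refine Finset.sum_congr rfl fun t _ => ?_
  rw [ContinuousLinearMap.integral_comp_comm _ (hi s t), Function.comp_apply, map_smul]

end DiracOfCauchyTransform

section UniqueContinuation
open Set Filter Topology Module Metric

/-- The coordinates of `M^n` as a Euclidean space. -/
def blockIso (n m : ℕ) : EuclideanSpace ℝ (Fin n × Fin (m + 1)) ≃L[ℝ] Mn n m :=
  (EuclideanSpace.equiv (Fin n × Fin (m + 1)) ℝ).trans
    (LinearEquiv.curry ℝ ℝ (Fin n) (Fin (m + 1))).toContinuousLinearEquiv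

theorem blockIso_basisFun (i : Fin n × Fin (m + 1)) :
    blockIso n m (EuclideanSpace.basisFun (Fin n × Fin (m + 1)) ℝ i) =
      Pi.single i.1 (Pi.single i.2 1) := by
  obtain ⟨j, s⟩ := i
  ext j' s'
  change EuclideanSpace.basisFun (Fin n × Fin (m + 1)) ℝ (j, s) (j', s') = _
  by_cases hj : j' = j
  · subst hj
    by_cases hs : s' = s
    · simp [hs]
    · simp [hs]
  · simp [hj]

variable {F : Type} [NormedAddCommGroup F] [NormedSpace ℝ F]

theorem lap_clm_comp {G : Type} [NormedAddCommGroup G] [NormedSpace ℝ G] (ℓ : F →L[ℝ] G)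
    {f : Mn n m → F} (hf : ContDiff ℝ 2 f) (j : Fin n) (x : Mn n m) :
    lap (fun z => ℓ (f z)) j x = ℓ (lap f j x) := by
  rw [lap, lap, map_sum]
  refine Finset.sum_congr rfl fun s _ => ?_
  have h : pd (fun z => ℓ (f z)) j s = fun z => ℓ (pd f j s z) :=
    funext fun z => pd_clm_comp ℓ j s (hf.differentiable two_ne_zero z)
  rw [h]
  exact pd_clm_comp ℓ j s ((contDiff_pd (k := 2) (l := 1) hf le_rfl j s).differentiable
    one_ne_zero x)

/-- Unique continuation for functions that are harmonic in each block of variables. -/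
theorem eqOn_zero_of_isPreconnected_of_lap_eq_zero (hN : 2 < n * (m + 1)) {f : Mn n m → F}
    (hf : ContDiff ℝ 2 f) {Ω s : Set (Mn n m)} (hΩ : IsOpen Ω)
    (hΔ : ∀ j, ∀ x ∈ Ω, lap f j x = 0) (hs : IsPreconnected s) (hsΩ : s ⊆ Ω) {a : Mn n m}
    (ha : a ∈ s) (hz : f =ᶠ[𝓝 a] 0) : ∀ x ∈ s, f x = 0 := by
  intro x hx
  refine (SeparatingDual.eq_zero_iff_forall_dual_eq_zero (R := ℝ) _).2 fun ℓ => ?_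
  have hfr : 2 < finrank ℝ (EuclideanSpace ℝ (Fin n × Fin (m + 1))) := by simpa using hN
  have : Nontrivial (EuclideanSpace ℝ (Fin n × Fin (m + 1))) :=
    nontrivial_of_finrank_pos (R := ℝ) (by omega)
  let T := blockIso n m
  have hu : ContDiff ℝ 2 fun z => ℓ (f z) := ℓ.contDiff.comp hf
  have hT : ∀ y, 0 + (T : EuclideanSpace ℝ (Fin n × Fin (m + 1)) →L[ℝ] Mn n m) y = T y := fun y =>
    zero_add _
  have key := eqOn_zero_of_isPreconnected_of_basisLaplacian_eq_zero
    (EuclideanSpace.basisFun (Fin n × Fin (m + 1)) ℝ) hfr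
    (u := fun y => ℓ (f (0 + (T : EuclideanSpace ℝ (Fin n × Fin (m + 1)) →L[ℝ] Mn n m) y)))
    (Ω := T ⁻¹' Ω) (s := T ⁻¹' s) (a := T.symm a)
    (hu.comp (contDiff_const.add (ContinuousLinearMap.contDiff _))) (hΩ.preimage T.continuous) ?_
    ?_ (preimage_mono hsΩ) (by simpa using ha) ?_ (T.symm x) (by simpa using hx)
  · simpa [hT] using key
  · intro y hy
    rw [basisLaplacian_slice _ _ hu, Fintype.sum_prod_type]
    refine Finset.sum_eq_zero fun j _ => ?_
    have h := lap_clm_comp ℓ hf j (T y)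
    rw [hΔ j _ hy, map_zero] at h
    rw [hT, ← h]
    refine Finset.sum_congr rfl fun t _ => ?_
    simp only [ContinuousLinearEquiv.coe_coe, T, blockIso_basisFun]
    rfl
  · exact T.toHomeomorph.isPreconnected_preimage.2 hs
  · have : Tendsto T (𝓝 (T.symm a)) (𝓝 a) := by
      simpa using T.continuous.tendsto (T.symm a)
    filter_upwards [this.eventually hz] with y hy
    simp [hy]

theorem tsol_eventuallyEq_zero (H : HCAlg 𝔸 m) (hn : 0 < n) {g : Mn n m → 𝔸} {R : ℝ}
    (hg : ∀ z, R < ‖z‖ → g z = 0) {i : Fin n} (hi : i ≠ ⟨0, hn⟩) {x : Mn n m} (hx : R < ‖x i‖) :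
    Tsol H hn g =ᶠ[𝓝 x] 0 := by
  have hopen : IsOpen {z : Mn n m | R < ‖z i‖} :=
    isOpen_lt continuous_const (continuous_apply i).norm
  filter_upwards [hopen.mem_nhds hx] with z hz
  have : ∀ y, g (Function.update z ⟨0, hn⟩ y) = 0 := fun y => by
    refine hg _ (lt_of_lt_of_le hz ?_)
    have := norm_le_pi_norm (Function.update z ⟨0, hn⟩ y) i
    rwa [Function.update_of_ne hi] at this
  simp [Tsol, this]

theorem exists_mem_connectedComponentIn_tsol_eventuallyEq_zero (H : HCAlg 𝔸 m) (hn : 1 < n)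
    {g : Mn n m → 𝔸} {R : ℝ} (hR : 0 < R) (hg : ∀ z, R < ‖z‖ → g z = 0) {Ω : Set (Mn n m)}
    (hΩ : ∀ z, R < ‖z‖ → z ∈ Ω) {q : Mn n m} (hq : R < ‖q‖) :
    ∃ a ∈ connectedComponentIn Ω q, Tsol H (zero_lt_one.trans hn) g =ᶠ[𝓝 a] 0 := by
  obtain ⟨i, hi⟩ : ∃ i, R < ‖q i‖ := by
    by_contra! h
    exact hq.not_ge ((pi_norm_le_iff_of_nonneg hR.le).2 h)
  by_cases hi0 : i = ⟨0, zero_lt_one.trans hn⟩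
  · let j : Fin n := ⟨1, hn⟩
    have hij : i ≠ j := by simp [hi0, j]
    have hj0 : j ≠ ⟨0, zero_lt_one.trans hn⟩ := hi0 ▸ hij.symm
    let c : Fin (m + 1) → ℝ := fun _ => R + 1
    refine ⟨Function.update q j c, ?_, tsol_eventuallyEq_zero H _ hg hj0 ?_⟩
    · refine (isPreconnected_range (f := Function.update q j) ?_).subset_connectedComponentIn
        ⟨q j, Function.update_eq_self j q⟩ ?_ ⟨c, rfl⟩
      · exact continuous_const.update j continuous_id
      · rintro _ ⟨y, rfl⟩
        refine hΩ _ (hi.trans_le ?_)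
        have := norm_le_pi_norm (Function.update q j y) i
        rwa [Function.update_of_ne hij] at this
    · rw [Function.update_self]
      refine lt_of_lt_of_le ?_ (norm_le_pi_norm c 0)
      simp only [c, Real.norm_eq_abs]
      exact lt_of_lt_of_le (lt_add_one R) (le_abs_self _)
  · exact ⟨q, mem_connectedComponentIn (hΩ q hq), tsol_eventuallyEq_zero H _ hg hi0 hi⟩

end UniqueContinuation

/-- (iii) ⇒ (i) of Theorem 5.2, with the explicit solution
`f(x) = −∫_M E(y₁ − x₁) g₁(y₁, x⁰) dV(y₁)`. -/
theorem compat_implies_explicit_solution (H : HCAlg 𝔸 m) (hn : 1 < n) (k : ℕ) (hk : 3 ≤ k)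
    (g : Fin n → Mn n m → 𝔸)
    (hg : ∀ j, ContDiff ℝ k (g j)) (hgs : ∀ j, HasCompactSupport (g j))
    (hcompat : ∀ (i j : Fin n) (x : Mn n m), dbar H (dconj H (g j) j) i x = lap (g i) j x) :
    ContDiff ℝ k (Tsol H (by omega) (g ⟨0, by omega⟩)) ∧
    HasCompactSupport (Tsol H (by omega) (g ⟨0, by omega⟩)) ∧
    (∀ (j : Fin n) (x : Mn n m), dbar H (Tsol H (by omega) (g ⟨0, by omega⟩)) j x = g j x) ∧
    ∀ x ∈ (⋃ j, tsupport (g j))ᶜ,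
      ¬ Bornology.IsBounded (connectedComponentIn ((⋃ j, tsupport (g j))ᶜ) x) →
        Tsol H (by omega) (g ⟨0, by omega⟩) x = 0 := by
  have hd : ∀ j x, dbar H (Tsol H (by omega) (g ⟨0, by omega⟩)) j x = g j x := fun j =>
    dbar_tsol H (by omega) ((hg _).of_le (by exact_mod_cast (by omega : 2 ≤ k))) (hgs _)
      ((hg j).of_le (by exact_mod_cast (by omega : 2 ≤ k))) (hgs j) j (hcompat j _)
  have hf := contDiff_tsol H (by omega) (hg ⟨0, by omega⟩) (hgs _)
  have hK : IsCompact (⋃ j, tsupport (g j)) := isCompact_iUnion fun j => (hgs j).isCompact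
  obtain ⟨R, hR, hKR⟩ := hK.isBounded.subset_closedBall_lt 0 0
  have hΩ : ∀ z, R < ‖z‖ → z ∈ (⋃ j, tsupport (g j))ᶜ := fun z hz hzK =>
    hz.not_ge (mem_closedBall_zero_iff.1 (hKR hzK))
  have hg0 : ∀ j, ∀ z ∈ (⋃ j, tsupport (g j))ᶜ, g j z = 0 := fun j z hz =>
    image_eq_zero_of_notMem_tsupport fun h => hz (Set.mem_iUnion.2 ⟨j, h⟩)
  have hzero : ∀ q, R < ‖q‖ → ∀ x ∈ connectedComponentIn ((⋃ j, tsupport (g j))ᶜ) q,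
      Tsol H (by omega) (g ⟨0, by omega⟩) x = 0 := by
    intro q hq
    obtain ⟨a, ha, haz⟩ := exists_mem_connectedComponentIn_tsol_eventuallyEq_zero H hn hR
      (fun z hz => hg0 ⟨0, by omega⟩ z (hΩ z hz)) hΩ hq
    have hf2 := hf.of_le (m := 2) (by exact_mod_cast (by omega : 2 ≤ k))
    have hm := H.hm
    exact eqOn_zero_of_isPreconnected_of_lap_eq_zero (by nlinarith) hf2
      hK.isClosed.isOpen_compl (fun j => lap_eq_zero_of_dbar_eq_zero H hf2
        hK.isClosed.isOpen_compl fun x hx => (hd j x).trans (hg0 j x hx))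
      isPreconnected_connectedComponentIn (connectedComponentIn_subset _ _) ha haz
  refine ⟨hf, HasCompactSupport.intro (isCompact_closedBall 0 R) fun x hx => ?_, hd,
    fun x _ hx => ?_⟩
  · have hx' : R < ‖x‖ := by simpa using hx
    exact hzero x hx' x (mem_connectedComponentIn (hΩ x hx'))
  · obtain ⟨q, hq, hqR⟩ : ∃ q ∈ connectedComponentIn ((⋃ j, tsupport (g j))ᶜ) x, R < ‖q‖ := by
      by_contra! h
      exact hx (Metric.isBounded_closedBall.subset fun q hq => mem_closedBall_zero_iff.2 (h q hq))
    refine hzero q hqR x ?_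
    rw [← connectedComponentIn_eq hq]
    exact mem_connectedComponentIn ‹_›

end
end

section
/- Let n > 1, k ≥ 1, and let g ∈ C_0^k(M^n, 𝔸) have compact support. Then the function f(x) := −∫_M E(y_1 − x_1) g(y_1, x^0) dV(y_1), for x = (x_1, x^0) = (x_1, x_2, …, x_n) ∈ M^n, is well defined, belongs to C^k(M^n, 𝔸), and satisfies ∂̄_1 f = g on all of M^n. -/
open MeasureTheory

noncomputable section

variable {𝔸 : Type} [NormedAddCommGroup 𝔸] [NormedSpace ℝ 𝔸] {m n : ℕ}

open Filter Topology Set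

/-- Linearized left alternativity. -/
lemma HCAlg.mul_mul_add_mul_mul_s5 (H : HCAlg 𝔸 m) (x y b : 𝔸) :
    H.mul x (H.mul y b) + H.mul y (H.mul x b) = H.mul (H.mul x y + H.mul y x) b := by
  have h := H.alt_left (x + y) b
  simp only [map_add, LinearMap.add_apply, H.alt_left x b, H.alt_left y b] at h
  simp only [map_add, LinearMap.add_apply]
  rw [← sub_eq_zero] at h ⊢
  rw [← h]
  abel

lemma HCAlg.conj_v_s5 (H : HCAlg 𝔸 m) {s : Fin (m + 1)} (hs : s ≠ 0) :
    H.conj (H.v s) = -H.v s :=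
  (neg_eq_of_add_eq_zero_right (H.v_trace s hs)).symm

lemma HCAlg.v_mul_conj_v_mul_self (H : HCAlg 𝔸 m) (s : Fin (m + 1)) (a : 𝔸) :
    H.mul (H.v s) (H.mul (H.conj (H.v s)) a) = a := by
  rcases eq_or_ne s 0 with rfl | hs
  · simp [H.v_zero, H.conj_one, H.one_mul']
  · have h := H.v_norm s hs
    rw [H.conj_v_s5 hs] at h ⊢
    simp only [map_neg, LinearMap.neg_apply] at h ⊢
    rw [H.alt_left, ← LinearMap.neg_apply, ← map_neg, h, H.one_mul']

lemma HCAlg.v_mul_conj_v_mul_swap (H : HCAlg 𝔸 m) {s t : Fin (m + 1)} (hst : s ≠ t) (a : 𝔸) :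
    H.mul (H.v s) (H.mul (H.conj (H.v t)) a) = -H.mul (H.v t) (H.mul (H.conj (H.v s)) a) := by
  rcases eq_or_ne s 0 with rfl | hs
  · simp [H.v_zero, H.conj_one, H.one_mul', H.conj_v_s5 hst.symm]
  rcases eq_or_ne t 0 with rfl | ht
  · simp [H.v_zero, H.conj_one, H.one_mul', H.conj_v_s5 hs]
  have h := H.mul_mul_add_mul_mul_s5 (H.v s) (H.v t) a
  rw [H.v_anticomm s t hs ht hst, neg_add_cancel, map_zero, LinearMap.zero_apply] at h
  rw [H.conj_v_s5 hs, H.conj_v_s5 ht]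
  simp only [map_neg, LinearMap.neg_apply, neg_neg]
  rw [← neg_eq_of_add_eq_zero_right h]

/-- The off-diagonal terms of `∑ v_s (v_t^c S_{st})` cancel when `S` is symmetric. -/
lemma HCAlg.sum_v_mul_conj_v_mul (H : HCAlg 𝔸 m) (S : Fin (m + 1) → Fin (m + 1) → 𝔸)
    (hS : ∀ s t, S s t = S t s) :
    ∑ s, ∑ t, H.mul (H.v s) (H.mul (H.conj (H.v t)) (S s t)) = ∑ s, S s s := by
  set A : Fin (m + 1) → Fin (m + 1) → 𝔸 :=
    fun s t => H.mul (H.v s) (H.mul (H.conj (H.v t)) (S s t)) with hA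
  have key : ∀ s t, A s t + A t s = if s = t then (2 : ℝ) • S s s else 0 := by
    intro s t
    split_ifs with h
    · subst h
      simp only [hA, H.v_mul_conj_v_mul_self, two_smul]
    · simp only [hA]
      rw [H.v_mul_conj_v_mul_swap h, hS s t, neg_add_cancel]
  have h2 : (2 : ℝ) • ∑ s, ∑ t, A s t = (2 : ℝ) • ∑ s, S s s := by
    rw [two_smul]
    nth_rewrite 2 [Finset.sum_comm]
    simp only [← Finset.sum_add_distrib, key, Finset.sum_ite_eq, Finset.mem_univ, if_true,
      Finset.smul_sum]
  exact smul_right_injective 𝔸 (two_ne_zero : (2 : ℝ) ≠ 0) h2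

/-- The scalar components `y_t / |y|^{m+1}` of the (unnormalized) Cauchy kernel. -/
def cauchyComp (t : Fin (m + 1)) (y : Fin (m + 1) → ℝ) : ℝ := y t / enormM y ^ (m + 1)

lemma CauchyE_eq_sum (H : HCAlg 𝔸 m) (y : Fin (m + 1) → ℝ) :
    CauchyE H y = (usigma (m + 1))⁻¹ • ∑ t, cauchyComp t y • H.conj (H.v t) := by
  simp only [CauchyE, embM, map_sum, map_smul, Finset.smul_sum, smul_smul, cauchyComp]
  refine Finset.sum_congr rfl fun t _ => ?_
  congr 1
  rw [mul_inv]
  ring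

lemma enormM_neg (y : Fin (m + 1) → ℝ) : enormM (-y) = enormM y := by
  simp [enormM]

lemma CauchyE_neg (H : HCAlg 𝔸 m) (y : Fin (m + 1) → ℝ) : CauchyE H (-y) = -CauchyE H y := by
  simp [CauchyE, embM, enormM_neg]

lemma abs_le_enormM (y : Fin (m + 1) → ℝ) (t : Fin (m + 1)) : |y t| ≤ enormM y :=
  Real.abs_le_sqrt (Finset.single_le_sum (f := fun s => y s ^ 2) (fun _ _ => sq_nonneg _)
    (Finset.mem_univ t))

lemma norm_le_enormM (y : Fin (m + 1) → ℝ) : ‖y‖ ≤ enormM y :=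
  (pi_norm_le_iff_of_nonneg (Real.sqrt_nonneg _)).2 (abs_le_enormM y)

lemma enormM_pos {y : Fin (m + 1) → ℝ} (hy : y ≠ 0) : 0 < enormM y :=
  (norm_pos_iff.2 hy).trans_le (norm_le_enormM y)

lemma abs_cauchyComp_le (t : Fin (m + 1)) (y : Fin (m + 1) → ℝ) :
    |cauchyComp t y| ≤ (‖y‖ ^ m)⁻¹ := by
  rcases eq_or_ne y 0 with rfl | hy
  · simp only [cauchyComp, Pi.zero_apply, zero_div, abs_zero]
    positivity
  · have h0 := enormM_pos hy
    have h1 := norm_pos_iff.2 hy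
    rw [cauchyComp, abs_div, abs_of_nonneg (pow_nonneg h0.le _)]
    calc |y t| / enormM y ^ (m + 1) ≤ enormM y / enormM y ^ (m + 1) := by
          gcongr
          exact abs_le_enormM y t
      _ = (enormM y ^ m)⁻¹ := by rw [pow_succ]; field_simp
      _ ≤ (‖y‖ ^ m)⁻¹ := by
          gcongr
          exact norm_le_enormM y

@[fun_prop]
lemma measurable_cauchyComp (t : Fin (m + 1)) : Measurable (cauchyComp t) := by
  unfold cauchyComp enormM
  fun_prop

lemma integrableOn_inv_norm_pow (r : ℝ) :
    IntegrableOn (fun y : Fin (m + 1) → ℝ => (‖y‖ ^ m)⁻¹) (Metric.ball 0 r) := by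
  rw [integrableOn_fun_norm_addHaar volume (f := fun s : ℝ => (s ^ m)⁻¹)]
  rw [integrableOn_congr_fun (g := fun _ => (1 : ℝ)) _ measurableSet_Ioo]
  · exact integrableOn_const (by simp)
  · intro s hs
    have : s ≠ 0 := hs.1.ne'
    simp [this]

lemma integrableOn_cauchyComp (t : Fin (m + 1)) (r : ℝ) :
    IntegrableOn (cauchyComp t) (Metric.ball 0 r) :=
  (integrableOn_inv_norm_pow r).mono' (measurable_cauchyComp t).aestronglyMeasurable
    (Eventually.of_forall (abs_cauchyComp_le t))

lemma locallyIntegrable_of_integrableOn_ball {E F : Type*} [NormedAddCommGroup E]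
    [MeasurableSpace E] [NormedAddCommGroup F] {μ : Measure E} {f : E → F}
    (hf : ∀ r, IntegrableOn f (Metric.ball 0 r) μ) : LocallyIntegrable f μ := fun x =>
  ⟨Metric.ball 0 (‖x‖ + 1), Metric.isOpen_ball.mem_nhds (by simp), hf _⟩

lemma locallyIntegrable_cauchyComp (t : Fin (m + 1)) :
    LocallyIntegrable (cauchyComp (m := m) t) :=
  locallyIntegrable_of_integrableOn_ball (integrableOn_cauchyComp t)

lemma locallyIntegrable_CauchyE (H : HCAlg 𝔸 m) : LocallyIntegrable (CauchyE H) := by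
  refine locallyIntegrable_of_integrableOn_ball fun r => ?_
  have : CauchyE H = fun y => (usigma (m + 1))⁻¹ • ∑ t, cauchyComp t y • H.conj (H.v t) :=
    funext (CauchyE_eq_sum H)
  rw [this]
  exact (integrable_finsetSum _ fun t _ => (integrableOn_cauchyComp t r).smul_const _).smul _

/-- The smooth profile `z_t (1 + |z|²)^{-(m+1)/2}` whose rescalings regularize `cauchyComp t`. -/
def regKer (t : Fin (m + 1)) (z : Fin (m + 1) → ℝ) : ℝ :=
  z t * (1 + ∑ i, z i ^ 2) ^ (-((m + 1 : ℝ) / 2))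

/-- The partial derivative of `regKer t` in the direction `s`. -/
def regKerDeriv (s t : Fin (m + 1)) (z : Fin (m + 1) → ℝ) : ℝ :=
  (if s = t then 1 else 0) * (1 + ∑ i, z i ^ 2) ^ (-((m + 1 : ℝ) / 2))
    + z t * (2 * z s * (-((m + 1 : ℝ) / 2)) * (1 + ∑ i, z i ^ 2) ^ (-((m + 1 : ℝ) / 2) - 1))

lemma one_add_sum_sq_pos (z : Fin (m + 1) → ℝ) : 0 < 1 + ∑ i, z i ^ 2 := by positivity

lemma regKerDeriv_comm (s t : Fin (m + 1)) (z : Fin (m + 1) → ℝ) :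
    regKerDeriv s t z = regKerDeriv t s z := by
  simp only [regKerDeriv, eq_comm (a := s)]
  ring

/-- The peak function obtained as the divergence of the regularized kernel. -/
def peak (z : Fin (m + 1) → ℝ) : ℝ :=
  (m + 1) * (1 + ∑ i, z i ^ 2) ^ (-((m + 1 : ℝ) / 2) - 1)

lemma sum_regKerDeriv (z : Fin (m + 1) → ℝ) : ∑ s, regKerDeriv s s z = peak z := by
  have hq := one_add_sum_sq_pos z
  have h : (1 + ∑ i, z i ^ 2) ^ (-((m + 1 : ℝ) / 2))
      = (1 + ∑ i, z i ^ 2) ^ (-((m + 1 : ℝ) / 2) - 1) * (1 + ∑ i, z i ^ 2) := by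
    rw [Real.rpow_sub_one hq.ne', div_mul_cancel₀ _ hq.ne']
  have h2 : ∀ s, z s * (2 * z s * (-((m + 1 : ℝ) / 2)) *
      (1 + ∑ i, z i ^ 2) ^ (-((m + 1 : ℝ) / 2) - 1)) =
      z s ^ 2 * (-(m + 1 : ℝ) * (1 + ∑ i, z i ^ 2) ^ (-((m + 1 : ℝ) / 2) - 1)) :=
    fun s => by ring
  simp only [regKerDeriv, if_true, one_mul, Finset.sum_add_distrib, h2, ← Finset.sum_mul,
    Finset.sum_const, Finset.card_univ, Fintype.card_fin, nsmul_eq_mul, peak]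
  rw [h]
  push_cast
  ring

lemma hasLineDerivAt_regKer (s t : Fin (m + 1)) (z : Fin (m + 1) → ℝ) :
    HasLineDerivAt ℝ (regKer t) (regKerDeriv s t z) z (Pi.single s 1) := by
  have hc : ∀ i, HasDerivAt (fun τ : ℝ => (z + τ • (Pi.single s (1 : ℝ) : Fin (m + 1) → ℝ)) i)
      (if s = i then 1 else 0) 0 := by
    intro i
    have := ((hasDerivAt_id (0 : ℝ)).mul_const ((Pi.single s (1 : ℝ) : Fin (m + 1) → ℝ) i)).const_add
      (z i)
    simpa [Pi.single_apply, eq_comm] using this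
  have hq : HasDerivAt (fun τ : ℝ => 1 + ∑ i, (z + τ • (Pi.single s (1 : ℝ) : Fin (m + 1) → ℝ)) i ^ 2)
      (2 * z s) 0 := by
    have := (HasDerivAt.fun_sum (u := Finset.univ) fun i _ => (hc i).pow 2).const_add 1
    simpa using this
  have hp := hq.rpow_const (p := -((m + 1 : ℝ) / 2)) (Or.inl (by positivity))
  have := (hc t).fun_mul hp
  simpa [HasLineDerivAt, regKer, regKerDeriv] using this

@[fun_prop]
lemma continuous_regKer (t : Fin (m + 1)) : Continuous (regKer t) := by
  unfold regKer
  exact (continuous_apply t).mul (Continuous.rpow_const (by fun_prop)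
    fun z => Or.inl (one_add_sum_sq_pos z).ne')

@[fun_prop]
lemma continuous_regKerDeriv (s t : Fin (m + 1)) : Continuous (regKerDeriv s t) := by
  unfold regKerDeriv
  have h : ∀ p : ℝ, Continuous fun z : Fin (m + 1) → ℝ => (1 + ∑ i, z i ^ 2) ^ p := fun p =>
    Continuous.rpow_const (by fun_prop) fun z => Or.inl (one_add_sum_sq_pos z).ne'
  exact (continuous_const.mul (h _)).add
    ((continuous_apply t).mul (((continuous_const.mul (continuous_apply s)).mul
      continuous_const).mul (h _)))

/-- The rescaled kernel in terms of Euclidean norms. -/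
lemma pow_mul_regKer_smul (t : Fin (m + 1)) {c : ℝ} (hc : 0 < c) (y : Fin (m + 1) → ℝ) :
    c ^ m * regKer t (c • y) = y t / Real.sqrt ((c ^ 2)⁻¹ + ∑ i, y i ^ 2) ^ (m + 1) := by
  have hA : 0 < (c ^ 2)⁻¹ + ∑ i, y i ^ 2 := by positivity
  have h1 : 1 + ∑ i, (c • y) i ^ 2 = c ^ 2 * ((c ^ 2)⁻¹ + ∑ i, y i ^ 2) := by
    simp only [Pi.smul_apply, smul_eq_mul, mul_pow, ← Finset.mul_sum]
    field_simp
  have h2 : ∀ a : ℝ, 0 ≤ a → a ^ (-((m + 1 : ℝ) / 2)) = (Real.sqrt a ^ (m + 1))⁻¹ := by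
    intro a ha
    rw [Real.rpow_neg ha, Real.sqrt_eq_rpow, ← Real.rpow_natCast, ← Real.rpow_mul ha]
    push_cast
    ring_nf
  rw [regKer, h1, h2 _ (by positivity), Real.sqrt_mul (by positivity), Real.sqrt_sq hc.le]
  have h3 : 0 < Real.sqrt ((c ^ 2)⁻¹ + ∑ i, y i ^ 2) := Real.sqrt_pos.2 hA
  rw [Pi.smul_apply, smul_eq_mul, mul_pow]
  generalize Real.sqrt ((c ^ 2)⁻¹ + ∑ i, y i ^ 2) = S at h3
  field_simp
  ring

lemma abs_pow_mul_regKer_smul_le (t : Fin (m + 1)) {c : ℝ} (hc : 0 < c) (y : Fin (m + 1) → ℝ) :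
    |c ^ m * regKer t (c • y)| ≤ |cauchyComp t y| := by
  rw [pow_mul_regKer_smul t hc]
  rcases eq_or_ne y 0 with rfl | hy
  · simp [cauchyComp]
  have h0 := enormM_pos hy
  rw [cauchyComp, abs_div, abs_div, abs_of_nonneg (pow_nonneg h0.le _),
    abs_of_nonneg (pow_nonneg (Real.sqrt_nonneg _) _)]
  gcongr
  exact Real.sqrt_le_sqrt (by simp only [le_add_iff_nonneg_left]; positivity)

lemma tendsto_pow_mul_regKer_smul (t : Fin (m + 1)) (y : Fin (m + 1) → ℝ) :
    Tendsto (fun c : ℝ => c ^ m * regKer t (c • y)) atTop (𝓝 (cauchyComp t y)) := by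
  rcases eq_or_ne y 0 with rfl | hy
  · simp [cauchyComp, regKer]
  have h0 := enormM_pos hy
  have h1 : Tendsto (fun c : ℝ => (c ^ 2)⁻¹ + ∑ i, y i ^ 2) atTop (𝓝 (0 + ∑ i, y i ^ 2)) :=
    ((tendsto_pow_atTop two_ne_zero).inv_tendsto_atTop).add_const _
  rw [zero_add] at h1
  have h2 := (tendsto_const_nhds (x := y t)).div ((h1.sqrt).pow (m + 1)) (pow_pos h0 _).ne'
  refine h2.congr' ?_
  filter_upwards [eventually_gt_atTop 0] with c hc
  exact (pow_mul_regKer_smul t hc y).symm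

section Peak

lemma integral_Ioi_radial_peak :
    ∫ r in Ioi (0 : ℝ), r ^ m * ((m + 1) * (1 + r ^ 2) ^ (-((m + 1 : ℝ) / 2) - 1)) = 1 := by
  have hd : ∀ r ∈ Ici (0 : ℝ), HasDerivAt
      (fun r : ℝ => r ^ (m + 1) * (1 + r ^ 2) ^ (-((m + 1 : ℝ) / 2)))
      (r ^ m * ((m + 1) * (1 + r ^ 2) ^ (-((m + 1 : ℝ) / 2) - 1))) r := by
    intro r _
    have hq : 0 < 1 + r ^ 2 := by positivity
    have h1 := ((hasDerivAt_id r).pow 2).const_add 1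
    have h2 := h1.rpow_const (p := -((m + 1 : ℝ) / 2)) (Or.inl hq.ne')
    have h3 := ((hasDerivAt_id r).pow (m + 1)).mul h2
    refine h3.congr_deriv ?_
    have h : (1 + r ^ 2) ^ (-((m + 1 : ℝ) / 2))
        = (1 + r ^ 2) ^ (-((m + 1 : ℝ) / 2) - 1) * (1 + r ^ 2) := by
      rw [Real.rpow_sub_one hq.ne', div_mul_cancel₀ _ hq.ne']
    simp only [id, Pi.pow_apply, Nat.add_sub_cancel]
    rw [h]
    push_cast
    ring
  have hl : Tendsto (fun r : ℝ => r ^ (m + 1) * (1 + r ^ 2) ^ (-((m + 1 : ℝ) / 2))) atTop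
      (𝓝 1) := by
    have h1 : Tendsto (fun c : ℝ => (c ^ 2)⁻¹ + 1) atTop (𝓝 (0 + 1)) :=
      ((tendsto_pow_atTop two_ne_zero).inv_tendsto_atTop).add_const _
    have h2 := h1.rpow_const (p := -((m + 1 : ℝ) / 2)) (Or.inl (by norm_num))
    rw [zero_add, Real.one_rpow] at h2
    refine h2.congr' ?_
    filter_upwards [eventually_gt_atTop 0] with c hc
    have : (c ^ 2)⁻¹ + 1 = (c ^ 2)⁻¹ * (1 + c ^ 2) := by field_simp
    rw [this, Real.mul_rpow (by positivity) (by positivity), Real.inv_rpow (by positivity),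
      Real.rpow_neg (by positivity) (_ / _), inv_inv, ← Real.rpow_natCast c 2,
      ← Real.rpow_mul hc.le, ← Real.rpow_natCast c (m + 1)]
    congr 2
    push_cast
    ring
  rw [integral_Ioi_of_hasDerivAt_of_nonneg' hd (fun r hr => ?_) hl]
  · simp
  · have : 0 < r := hr
    positivity

lemma usigma_pos_s5 : 0 < usigma (m + 1) := by
  unfold usigma
  have : 0 < Real.Gamma (((m + 1 : ℕ) : ℝ) / 2) := Real.Gamma_pos_of_pos (by positivity)
  positivity

lemma integral_peak : ∫ z : Fin (m + 1) → ℝ, peak z = usigma (m + 1) := by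
  rw [← (PiLp.volume_preserving_ofLp (Fin (m + 1))).integral_comp
    (MeasurableEquiv.toLp 2 (Fin (m + 1) → ℝ)).symm.measurableEmbedding]
  have h : ∀ z : EuclideanSpace ℝ (Fin (m + 1)), peak (WithLp.ofLp z) =
      (fun r : ℝ => (m + 1) * (1 + r ^ 2) ^ (-((m + 1 : ℝ) / 2) - 1)) ‖z‖ := by
    intro z
    simp [peak, EuclideanSpace.norm_sq_eq]
  simp_rw [h]
  rw [integral_fun_norm_addHaar volume
    (fun r : ℝ => ((m : ℝ) + 1) * (1 + r ^ 2) ^ (-((m + 1 : ℝ) / 2) - 1))]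
  simp only [finrank_euclideanSpace, Fintype.card_fin, Nat.add_sub_cancel, smul_eq_mul,
    nsmul_eq_mul]
  rw [integral_Ioi_radial_peak, Measure.real, EuclideanSpace.volume_ball]
  have hg : 0 < Real.Gamma (((m + 1 : ℕ) : ℝ) / 2) := Real.Gamma_pos_of_pos (by positivity)
  have hG : Real.Gamma (((m + 1 : ℕ) : ℝ) / 2 + 1) =
      ((m + 1 : ℕ) : ℝ) / 2 * Real.Gamma (((m + 1 : ℕ) : ℝ) / 2) :=
    Real.Gamma_add_one (by positivity)
  have hpi : √Real.pi ^ (m + 1) = Real.pi ^ (((m + 1 : ℕ) : ℝ) / 2) := by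
    rw [Real.sqrt_eq_rpow, ← Real.rpow_natCast, ← Real.rpow_mul Real.pi_pos.le]
    congr 1
    ring
  simp only [ENNReal.ofReal_one, one_pow, one_mul, Fintype.card_fin, mul_one]
  rw [ENNReal.toReal_ofReal (by rw [hG]; positivity), hG, hpi, usigma]
  field_simp

lemma tendsto_norm_pow_mul_peak :
    Tendsto (fun z : Fin (m + 1) → ℝ => ‖z‖ ^ (m + 1) * peak z) (Bornology.cobounded _)
      (𝓝 0) := by
  have h1 : Tendsto (fun z : Fin (m + 1) → ℝ => ((m : ℝ) + 1) * (1 + ‖z‖ ^ 2)⁻¹)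
      (Bornology.cobounded _) (𝓝 (((m : ℝ) + 1) * 0)) := by
    refine Tendsto.const_mul _ (Tendsto.inv_tendsto_atTop ?_)
    exact tendsto_atTop_add_const_left _ _
      ((tendsto_pow_atTop two_ne_zero).comp tendsto_norm_cobounded_atTop)
  rw [mul_zero] at h1
  refine squeeze_zero (fun z => ?_) (fun z => ?_) h1
  · unfold peak
    positivity
  · have hz : ‖z‖ ^ 2 ≤ ∑ i, z i ^ 2 := by
      have h := pow_le_pow_left₀ (norm_nonneg z) (norm_le_enormM z) 2
      rwa [enormM, Real.sq_sqrt (by positivity)] at h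
    have hq := one_add_sum_sq_pos z
    have h2 : ‖z‖ ^ (m + 1) ≤ (1 + ∑ i, z i ^ 2) ^ ((m + 1 : ℝ) / 2) := by
      calc ‖z‖ ^ (m + 1) = (‖z‖ ^ 2) ^ ((m + 1 : ℝ) / 2) := by
            rw [← Real.rpow_natCast ‖z‖ 2, ← Real.rpow_mul (norm_nonneg z), ← Real.rpow_natCast]
            congr 1
            push_cast
            ring
        _ ≤ _ := by
            gcongr
            linarith
    calc ‖z‖ ^ (m + 1) * peak z
        ≤ (1 + ∑ i, z i ^ 2) ^ ((m + 1 : ℝ) / 2) * peak z := by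
          gcongr
          unfold peak
          positivity
      _ = (m + 1) * (1 + ∑ i, z i ^ 2)⁻¹ := by
          rw [peak, Real.rpow_sub_one hq.ne', Real.rpow_neg hq.le]
          field_simp
      _ ≤ _ := by gcongr

end Peak

section Kernel

variable {w : (Fin (m + 1) → ℝ) → 𝔸}

/-- Integration by parts against the rescaled regularized kernel. -/
lemma integral_regKer_smul_pd1 (hw : ContDiff ℝ 1 w) (hws : HasCompactSupport w)
    (s t : Fin (m + 1)) (c : ℝ) :
    ∫ y, (c ^ m * regKer t (c • y)) • pd1 w s y =
      -∫ y, (c ^ (m + 1) * regKerDeriv s t (c • y)) • w y := by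
  have hw' : Continuous (pd1 w s) := (hw.continuous_fderiv one_ne_zero).clm_apply continuous_const
  have hws' : HasCompactSupport (pd1 w s) := hws.fderiv_apply ℝ _
  refine integral_bilinear_hasLineDerivAt_right_eq_neg_left_of_integrable
    (B := ContinuousLinearMap.lsmul ℝ ℝ) (v := Pi.single s 1) ?_ ?_ ?_ ?_ ?_
  · exact Continuous.integrable_of_hasCompactSupport
      (Continuous.smul (by fun_prop) hw.continuous) hws.smul_left
  · exact Continuous.integrable_of_hasCompactSupport
      (Continuous.smul (by fun_prop) hw') hws'.smul_left
  · exact Continuous.integrable_of_hasCompactSupport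
      (Continuous.smul (by fun_prop) hw.continuous) hws.smul_left
  · intro y _
    have h := hasLineDerivAt_regKer s t (c • y)
    have h1 : HasDerivAt (fun τ : ℝ => regKer t (c • y + τ • Pi.single s (1 : ℝ)))
      (regKerDeriv s t (c • y)) (c * 0) := by simpa [HasLineDerivAt] using h
    have h2 := (h1.comp 0 ((hasDerivAt_id (0 : ℝ)).const_mul c)).const_mul (c ^ m)
    simp only [HasLineDerivAt, smul_add, smul_smul]
    refine (h2.congr_deriv ?_)
    ring
  · intro y _
    exact (hw.differentiable one_ne_zero y).hasFDerivAt.hasLineDerivAt _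

lemma tendsto_integral_regKer_smul_pd1 (hw : ContDiff ℝ 1 w) (hws : HasCompactSupport w)
    (s t : Fin (m + 1)) :
    Tendsto (fun c : ℝ => ∫ y, (c ^ m * regKer t (c • y)) • pd1 w s y) atTop
      (𝓝 (∫ y, cauchyComp t y • pd1 w s y)) := by
  have hw' : Continuous (pd1 w s) := (hw.continuous_fderiv one_ne_zero).clm_apply continuous_const
  have hws' : HasCompactSupport (pd1 w s) := hws.fderiv_apply ℝ _
  have hint : Integrable fun y => cauchyComp t y • pd1 w s y :=
    (locallyIntegrable_cauchyComp t).integrable_smul_right_of_hasCompactSupport hw' hws'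
  refine tendsto_integral_filter_of_dominated_convergence _ ?_ ?_ hint.norm ?_
  · exact Eventually.of_forall fun c =>
      (Continuous.smul (by fun_prop) hw').aestronglyMeasurable
  · filter_upwards [eventually_gt_atTop 0] with c hc
    refine Eventually.of_forall fun y => ?_
    rw [norm_smul, norm_smul]
    gcongr
    exact abs_pow_mul_regKer_smul_le t hc y
  · exact Eventually.of_forall fun y => (tendsto_pow_mul_regKer_smul t y).smul_const _

lemma integral_cauchyComp_smul_pd1_comm (hw : ContDiff ℝ 1 w) (hws : HasCompactSupport w)
    (s t : Fin (m + 1)) :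
    ∫ y, cauchyComp t y • pd1 w s y = ∫ y, cauchyComp s y • pd1 w t y := by
  refine tendsto_nhds_unique (tendsto_integral_regKer_smul_pd1 hw hws s t) ?_
  refine (tendsto_integral_regKer_smul_pd1 hw hws t s).congr fun c => ?_
  simp only [integral_regKer_smul_pd1 hw hws, regKerDeriv_comm s t]

lemma sum_integral_cauchyComp_smul_pd1 [CompleteSpace 𝔸] (hw : ContDiff ℝ 1 w) (hws : HasCompactSupport w) :
    ∑ s, ∫ y, cauchyComp s y • pd1 w s y = -(usigma (m + 1) • w 0) := by
  refine tendsto_nhds_unique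
    (tendsto_finsetSum _ fun s _ => tendsto_integral_regKer_smul_pd1 hw hws s s) ?_
  have hσ := usigma_pos_s5 (m := m)
  have hp := tendsto_integral_comp_smul_smul_of_integrable (μ := volume)
    (φ := fun z : Fin (m + 1) → ℝ => (usigma (m + 1))⁻¹ * peak z)
    (fun z => by unfold peak; positivity)
    (by rw [integral_const_mul, integral_peak, inv_mul_cancel₀ hσ.ne'])
    (by
      have := (tendsto_norm_pow_mul_peak (m := m)).const_mul (usigma (m + 1))⁻¹
      rw [mul_zero] at this
      refine this.congr fun z => ?_
      rw [Module.finrank_fin_fun]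
      ring)
    (hw.continuous.integrable_of_hasCompactSupport hws) hw.continuous.continuousAt
  refine ((hp.const_smul (usigma (m + 1))).neg).congr fun c => ?_
  simp only [integral_regKer_smul_pd1 hw hws, Finset.sum_neg_distrib, Module.finrank_fin_fun]
  rw [← integral_smul, ← integral_finsetSum]
  · congr 2 with y
    rw [← Finset.sum_smul, ← Finset.mul_sum, sum_regKerDeriv, smul_smul]
    congr 1
    field_simp
  · intro s _
    exact Continuous.integrable_of_hasCompactSupport
      (Continuous.smul (by fun_prop) hw.continuous) hws.smul_left

end Kernel

/-- The Cauchy kernel is a fundamental solution: the weak form of `∂̄ E = δ`. -/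
lemma sum_v_mul_integral_CauchyE_mul_pd1 (H : HCAlg 𝔸 m) {w : (Fin (m + 1) → ℝ) → 𝔸}
    (hw : ContDiff ℝ 1 w) (hws : HasCompactSupport w) :
    ∑ s, H.mul (H.v s) (∫ y, H.mul (CauchyE H y) (pd1 w s y)) = -w 0 := by
  have := H.findim
  have : CompleteSpace 𝔸 := FiniteDimensional.complete ℝ 𝔸
  have hint : ∀ s t, Integrable fun y => cauchyComp t y • pd1 w s y := fun s t =>
    (locallyIntegrable_cauchyComp t).integrable_smul_right_of_hasCompactSupport
      ((hw.continuous_fderiv one_ne_zero).clm_apply continuous_const) (hws.fderiv_apply ℝ _)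
  have hE : ∀ s, ∫ y, H.mul (CauchyE H y) (pd1 w s y) = (usigma (m + 1))⁻¹ •
      ∑ t, H.mul (H.conj (H.v t)) (∫ y, cauchyComp t y • pd1 w s y) := by
    intro s
    have hL : ∀ t, H.mul (H.conj (H.v t)) (∫ y, cauchyComp t y • pd1 w s y) =
        ∫ y, H.mul (H.conj (H.v t)) (cauchyComp t y • pd1 w s y) := fun t =>
      ((H.mul (H.conj (H.v t))).toContinuousLinearMap.integral_comp_comm (hint s t)).symm
    simp only [hL]
    have hI : ∀ t, Integrable fun y => H.mul (H.conj (H.v t)) (cauchyComp t y • pd1 w s y) :=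
      fun t => (H.mul (H.conj (H.v t))).toContinuousLinearMap.integrable_comp (hint s t)
    rw [← integral_finsetSum _ fun t _ => hI t, ← integral_smul]
    congr 1 with y
    simp [CauchyE_eq_sum, map_sum, LinearMap.sum_apply]
  simp only [hE, map_smul, map_sum, ← Finset.smul_sum]
  rw [H.sum_v_mul_conj_v_mul (fun s t => ∫ y, cauchyComp t y • pd1 w s y)
    (integral_cauchyComp_smul_pd1_comm hw hws), sum_integral_cauchyComp_smul_pd1 hw hws, smul_neg,
    smul_smul, inv_mul_cancel₀ usigma_pos_s5.ne', one_smul]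

/-- The algebra multiplication as a continuous bilinear map. -/
def HCAlg.mulL (H : HCAlg 𝔸 m) : 𝔸 →L[ℝ] 𝔸 →L[ℝ] 𝔸 :=
  haveI := H.findim
  H.mul.toContinuousBilinearMap

lemma HCAlg.mulL_apply (H : HCAlg 𝔸 m) (a b : 𝔸) : H.mulL a b = H.mul a b := rfl

open scoped Convolution

lemma CauchyE_sub_comm (H : HCAlg 𝔸 m) (y z : Fin (m + 1) → ℝ) :
    CauchyE H (y - z) = -CauchyE H (z - y) := by
  rw [← CauchyE_neg, neg_sub]

/-- `Tsol` is a convolution with the Cauchy kernel in the first variable. -/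
lemma Tsol_eq_convolution (H : HCAlg 𝔸 m) (hn : 0 < n) (g : Mn n m → 𝔸) (x : Mn n m) :
    Tsol H hn g x = (CauchyE H ⋆[H.mulL] fun z => g (Function.update x ⟨0, hn⟩ z)) (x ⟨0, hn⟩) := by
  simp only [Tsol, convolution_def, H.mulL_apply]
  rw [← integral_sub_left_eq_self _ volume (x ⟨0, hn⟩), ← integral_neg]
  congr 1 with y
  rw [CauchyE_sub_comm]
  simp

lemma eq_zero_of_notMem_image_tsupport {E : Type*} [Zero E] {g : Mn n m → E} (j : Fin n)
    (x : Mn n m) {z : Fin (m + 1) → ℝ} (hz : z ∉ (fun y : Mn n m => y j) '' tsupport g) :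
    g (Function.update x j z) = 0 := by
  by_contra h
  exact hz ⟨_, subset_tsupport _ h, by simp⟩

lemma contDiff_update_apply {k : WithTop ℕ∞} (j : Fin n) :
    ContDiff ℝ k fun q : Mn n m × (Fin (m + 1) → ℝ) => Function.update q.1 j q.2 := by
  rw [contDiff_pi]
  intro i
  rcases eq_or_ne i j with rfl | h
  · simpa using contDiff_snd
  · simp only [Function.update_of_ne h]
    fun_prop

lemma contDiff_Tsol (H : HCAlg 𝔸 m) (hn : 0 < n) {k : ℕ} {g : Mn n m → 𝔸} (hg : ContDiff ℝ k g)
    (hgs : HasCompactSupport g) : ContDiff ℝ k (Tsol H hn g) := by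
  have h := contDiffOn_convolution_right_with_param (μ := volume) (n := (k : ℕ∞)) H.mulL
    (g := fun (p : Mn n m) z => g (Function.update p ⟨0, hn⟩ z)) isOpen_univ
    (hgs.isCompact.image (continuous_apply (⟨0, hn⟩ : Fin n)))
    (fun p z _ hz => eq_zero_of_notMem_image_tsupport _ p hz) (locallyIntegrable_CauchyE H)
    ((hg.comp (contDiff_update_apply ⟨0, hn⟩)).contDiffOn)
  rw [univ_prod_univ, contDiffOn_univ] at h
  have h2 : ContDiff ℝ k fun x : Mn n m => (x, x ⟨0, hn⟩) := by fun_prop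
  have := h.comp h2
  rwa [funext (Tsol_eq_convolution H hn g)]

lemma hasCompactSupport_update {E : Type*} [Zero E] {g : Mn n m → E}
    (hgs : HasCompactSupport g) (j : Fin n) (x : Mn n m) : HasCompactSupport fun z => g (Function.update x j z) :=
  HasCompactSupport.intro (hgs.isCompact.image (continuous_apply j))
    fun _ hz => eq_zero_of_notMem_image_tsupport j x hz

lemma contDiff_comp_update {k : WithTop ℕ∞} {g : Mn n m → 𝔸} (hg : ContDiff ℝ k g) (j : Fin n)
    (x : Mn n m) : ContDiff ℝ k fun z => g (Function.update x j z) :=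
  hg.comp ((contDiff_update_apply j).comp (contDiff_prodMk_right x))

lemma pd_Tsol (H : HCAlg 𝔸 m) (hn : 0 < n) {g : Mn n m → 𝔸} (hg : ContDiff ℝ 1 g)
    (hgs : HasCompactSupport g) (s : Fin (m + 1)) (x : Mn n m) :
    pd (Tsol H hn g) ⟨0, hn⟩ s x = ∫ t, H.mul (CauchyE H t)
      (pd1 (fun z => g (Function.update x ⟨0, hn⟩ z)) s (x ⟨0, hn⟩ - t)) := by
  set j : Fin n := ⟨0, hn⟩
  set u : (Fin (m + 1) → ℝ) → 𝔸 := fun z => g (Function.update x j z) with hu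
  have hu1 : ContDiff ℝ 1 u := contDiff_comp_update hg j x
  have hus : HasCompactSupport u := hasCompactSupport_update hgs j x
  have hconv := hus.hasFDerivAt_convolution_right H.mulL (locallyIntegrable_CauchyE H) hu1 (x j)
  have hT : HasFDerivAt (Tsol H hn g) (fderiv ℝ (Tsol H hn g) x) (Function.update x j (x j)) := by
    rw [Function.update_eq_self]
    exact ((contDiff_Tsol H hn (k := 1) hg hgs).differentiable (by simp) x).hasFDerivAt
  have hcomp := hT.comp (x j) (hasFDerivAt_update x (x j))
  have heq : Tsol H hn g ∘ Function.update x j = CauchyE H ⋆[H.mulL] u := by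
    ext z
    simp [Tsol_eq_convolution, j, hu]
  rw [heq] at hcomp
  have h := congrArg (fun T => T (Pi.single s 1)) (hcomp.unique hconv)
  rw [convolution_precompR_apply _ (locallyIntegrable_CauchyE H) (hus.fderiv ℝ)
    (hu1.continuous_fderiv one_ne_zero)] at h
  refine Eq.trans ?_ h
  simp only [pd, ContinuousLinearMap.comp_apply]
  congr 1
  ext i l
  rcases eq_or_ne i j with rfl | hij <;> simp [*]

lemma dbar_Tsol (H : HCAlg 𝔸 m) (hn : 0 < n) {g : Mn n m → 𝔸} (hg : ContDiff ℝ 1 g)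
    (hgs : HasCompactSupport g) (x : Mn n m) : dbar H (Tsol H hn g) ⟨0, hn⟩ x = g x := by
  set j : Fin n := ⟨0, hn⟩
  set u : (Fin (m + 1) → ℝ) → 𝔸 := fun z => g (Function.update x j z) with hu
  have hu1 : ContDiff ℝ 1 u := contDiff_comp_update hg j x
  have hus : HasCompactSupport u := hasCompactSupport_update hgs j x
  have hw : ContDiff ℝ 1 fun y => u (x j - y) := hu1.comp (contDiff_const.sub contDiff_id)
  have hws : HasCompactSupport fun y => u (x j - y) :=
    hus.comp_homeomorph (Homeomorph.subLeft (x j))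
  have hpd : ∀ s y, pd1 (fun y => u (x j - y)) s y = -pd1 u s (x j - y) := by
    intro s y
    simp only [pd1]
    have h := (hu1.differentiable one_ne_zero (x j - y)).hasFDerivAt.comp y
      ((hasFDerivAt_id y).const_sub (x j))
    rw [show (fun y => u (x j - y)) = u ∘ HSub.hSub (x j) from rfl, h.fderiv]
    simp
  have h := sum_v_mul_integral_CauchyE_mul_pd1 H hw hws
  simp only [hpd, map_neg, integral_neg, Finset.sum_neg_distrib, neg_inj, sub_zero] at h
  simp only [dbar, j, pd_Tsol H hn hg hgs]
  rw [h]
  simp [hu]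

lemma integrable_CauchyE_sub_mul (H : HCAlg 𝔸 m) {u : (Fin (m + 1) → ℝ) → 𝔸}
    (hu : Continuous u) (hus : HasCompactSupport u) (z : Fin (m + 1) → ℝ) :
    Integrable fun y => H.mul (CauchyE H (y - z)) (u y) := by
  have h : Integrable fun t => H.mulL (CauchyE H t) (u (z - t)) :=
    hus.convolutionExists_right H.mulL (locallyIntegrable_CauchyE H) hu z
  refine (h.comp_sub_left z).neg.congr (Eventually.of_forall fun y => ?_)
  simp [H.mulL_apply, CauchyE_sub_comm H y z]

/-- For compactly supported `g ∈ C₀^k(M^n, 𝔸)` (`n > 1`, `k ≥ 1`), the function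
`f(x) = −∫_M E(y₁ − x₁) g(y₁, x⁰) dV(y₁)` is well defined, is of class `C^k`,
and satisfies `∂̄₁ f = g` on all of `M^n`. -/
theorem Tsol_dbar_first (H : HCAlg 𝔸 m) (hn : 1 < n) (k : ℕ) (hk : 1 ≤ k)
    (g : Mn n m → 𝔸) (hg : ContDiff ℝ k g) (hgs : HasCompactSupport g) :
    (∀ x : Mn n m, Integrable (fun y1 : Fin (m + 1) → ℝ =>
        H.mul (CauchyE H (y1 - x ⟨0, by omega⟩)) (g (Function.update x ⟨0, by omega⟩ y1)))) ∧
    ContDiff ℝ k (Tsol H (by omega) g) ∧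
    ∀ x : Mn n m, dbar H (Tsol H (by omega) g) ⟨0, by omega⟩ x = g x := by
  have hg1 : ContDiff ℝ 1 g := hg.of_le (by exact_mod_cast hk)
  exact ⟨fun x => integrable_CauchyE_sub_mul H (contDiff_comp_update hg1 _ x).continuous
    (hasCompactSupport_update hgs _ x) _, contDiff_Tsol H _ hg hgs, dbar_Tsol H _ hg1 hgs⟩

end
end
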